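/- arXiv:1001.4866 — 2 statements merged into one kernel-verified Lean document; each statement's English description precedes it below -/
import Mathlib

section
/- There exists μ₀ > 0 such that for every μ ≥ μ₀, the infimum of V_m over the open set 𝔅_μ is strictly smaller than the infimum of V_m over the boundary ∂𝔅_μ of 𝔅_μ in (ℝ²)^N. -/
open Finset

/-- The potential `V_m(ζ) = (1/(8π)) Σ_{j≠k} m_j m_k/|ζ_k−ζ_j| + (1/2) Σ_j m_j |ζ_j|²`
on configurations of `N` points in the plane, identified with `ℂ`. -/
noncomputable def Vm (N : ℕ) (m : Fin N → ℝ) (ζ : Fin N → ℂ) : ℝ :=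
  (1 / (8 * Real.pi)) * ∑ j : Fin N, ∑ k ∈ Finset.univ.erase j, m j * m k / ‖ζ k - ζ j‖
    + (1 / 2) * ∑ j : Fin N, m j * ‖ζ j‖ ^ 2

/-- The open set `𝔅_μ = {ζ : |ζ_i| < μ ∀i, |ζ_i − ζ_j| > μ⁻¹ ∀ i ≠ j}`. -/
def Bmu (N : ℕ) (μ : ℝ) : Set (Fin N → ℂ) :=
  {ζ | (∀ i, ‖ζ i‖ < μ) ∧ ∀ i j, i ≠ j → μ⁻¹ < ‖ζ i - ζ j‖}

theorem Vm_nonneg {N : ℕ} {m : Fin N → ℝ} (hm : ∀ j, 0 < m j) (ζ : Fin N → ℂ) :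
    0 ≤ Vm N m ζ := by
  have h1 : 0 ≤ ∑ j : Fin N, ∑ k ∈ Finset.univ.erase j, m j * m k / ‖ζ k - ζ j‖ :=
    sum_nonneg fun j _ => sum_nonneg fun k _ =>
      div_nonneg (mul_pos (hm j) (hm k)).le (norm_nonneg _)
  have h2 : 0 ≤ ∑ j : Fin N, m j * ‖ζ j‖ ^ 2 :=
    sum_nonneg fun j _ => mul_nonneg (hm j).le (sq_nonneg _)
  unfold Vm
  positivity

/-- The confining energy of a single point bounds `V_m` from below. -/
theorem confinement_le_Vm {N : ℕ} {m : Fin N → ℝ} (hm : ∀ j, 0 < m j) (ζ : Fin N → ℂ)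
    (i : Fin N) : 1 / 2 * (m i * ‖ζ i‖ ^ 2) ≤ Vm N m ζ := by
  have h1 : 0 ≤ ∑ j : Fin N, ∑ k ∈ Finset.univ.erase j, m j * m k / ‖ζ k - ζ j‖ :=
    sum_nonneg fun j _ => sum_nonneg fun k _ =>
      div_nonneg (mul_pos (hm j) (hm k)).le (norm_nonneg _)
  have h2 : m i * ‖ζ i‖ ^ 2 ≤ ∑ j : Fin N, m j * ‖ζ j‖ ^ 2 :=
    single_le_sum (f := fun j => m j * ‖ζ j‖ ^ 2)
      (fun j _ => mul_nonneg (hm j).le (sq_nonneg _)) (mem_univ i)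
  have h3 : 0 ≤ 1 / (8 * Real.pi) := by positivity
  unfold Vm
  nlinarith [mul_nonneg h3 h1]

/-- The interaction energy of a single pair bounds `V_m` from below. -/
theorem interaction_le_Vm {N : ℕ} {m : Fin N → ℝ} (hm : ∀ j, 0 < m j) (ζ : Fin N → ℂ)
    {i j : Fin N} (hij : i ≠ j) :
    1 / (8 * Real.pi) * (m i * m j / ‖ζ j - ζ i‖) ≤ Vm N m ζ := by
  have h0 : ∀ j k : Fin N, 0 ≤ m j * m k / ‖ζ k - ζ j‖ := fun j k =>
    div_nonneg (mul_pos (hm j) (hm k)).le (norm_nonneg _)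
  have h1 : m i * m j / ‖ζ j - ζ i‖ ≤ ∑ k ∈ Finset.univ.erase i, m i * m k / ‖ζ k - ζ i‖ :=
    single_le_sum (f := fun k => m i * m k / ‖ζ k - ζ i‖) (fun k _ => h0 i k)
      (mem_erase.2 ⟨hij.symm, mem_univ j⟩)
  have h2 : ∑ k ∈ Finset.univ.erase i, m i * m k / ‖ζ k - ζ i‖ ≤
      ∑ j : Fin N, ∑ k ∈ Finset.univ.erase j, m j * m k / ‖ζ k - ζ j‖ :=
    single_le_sum (f := fun j => ∑ k ∈ Finset.univ.erase j, m j * m k / ‖ζ k - ζ j‖)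
      (fun j _ => sum_nonneg fun k _ => h0 j k) (mem_univ i)
  have h3 : 0 ≤ ∑ j : Fin N, m j * ‖ζ j‖ ^ 2 :=
    sum_nonneg fun j _ => mul_nonneg (hm j).le (sq_nonneg _)
  have h4 : 0 ≤ 1 / (8 * Real.pi) := by positivity
  have h5 := mul_le_mul_of_nonneg_left (h1.trans h2) h4
  unfold Vm
  linarith

theorem isOpen_Bmu (N : ℕ) (μ : ℝ) : IsOpen (Bmu N μ) := by
  simp only [Bmu, Set.ofPred_and, Set.ofPred_forall]
  refine IsOpen.inter ?_ ?_
  · exact isOpen_iInter_of_finite fun i => isOpen_lt (by fun_prop) continuous_const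
  · exact isOpen_iInter_of_finite fun i => isOpen_iInter_of_finite fun j =>
      isOpen_iInter_of_finite fun _ => isOpen_lt continuous_const (by fun_prop)

theorem closure_Bmu_subset (N : ℕ) (μ : ℝ) :
    closure (Bmu N μ) ⊆
      {ζ | (∀ i, ‖ζ i‖ ≤ μ) ∧ ∀ i j, i ≠ j → μ⁻¹ ≤ ‖ζ i - ζ j‖} := by
  refine closure_minimal
    (fun ζ h => ⟨fun i => (h.1 i).le, fun i j hij => (h.2 i j hij).le⟩) ?_
  simp only [Set.ofPred_and, Set.ofPred_forall]
  refine IsClosed.inter ?_ ?_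
  · exact isClosed_iInter fun i => isClosed_le (by fun_prop) continuous_const
  · exact isClosed_iInter fun i => isClosed_iInter fun j =>
      isClosed_iInter fun _ => isClosed_le continuous_const (by fun_prop)

theorem norm_eq_of_mem_frontier_Bmu {N : ℕ} {μ : ℝ} {ζ : Fin N → ℂ}
    (h : ζ ∈ frontier (Bmu N μ)) :
    (∃ i, ‖ζ i‖ = μ) ∨ ∃ i j, i ≠ j ∧ ‖ζ i - ζ j‖ = μ⁻¹ := by
  rw [(isOpen_Bmu N μ).frontier_eq] at h
  obtain ⟨h1, h2⟩ := closure_Bmu_subset N μ h.1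
  by_contra! hc
  exact h.2 ⟨fun i => lt_of_le_of_ne (h1 i) (hc.1 i),
    fun i j hij => lt_of_le_of_ne (h2 i j hij) (hc.2 i j hij).symm⟩

/-- Equally spaced points on the real axis lie in `𝔅_μ` as soon as `μ > 1` and `μ ≥ N`. -/
theorem natCast_mem_Bmu {N : ℕ} {μ : ℝ} (h1 : 1 < μ) (hN : (N : ℝ) ≤ μ) :
    (fun i : Fin N => ((i : ℕ) : ℂ)) ∈ Bmu N μ := by
  refine ⟨fun i => ?_, fun i j hij => (inv_lt_one_of_one_lt₀ h1).trans_le ?_⟩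
  · rw [Complex.norm_natCast]
    exact (Nat.cast_lt.2 i.2).trans_le hN
  · have hne : ((i : ℕ) : ℤ) - ((j : ℕ) : ℤ) ≠ 0 := by
      have := Fin.val_ne_of_ne hij
      omega
    have h : ((i : ℕ) : ℂ) - ((j : ℕ) : ℂ) = ((((i : ℕ) : ℤ) - ((j : ℕ) : ℤ) : ℤ) : ℂ) := by
      push_cast
      rfl
    simp only [h, Complex.norm_intCast]
    exact_mod_cast Int.one_le_abs hne

theorem frontier_Bmu_nonempty {N : ℕ} (hN : 2 ≤ N) {μ : ℝ} (h1 : 1 < μ) (hμ : (N : ℝ) ≤ μ) :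
    (frontier (Bmu N μ)).Nonempty := by
  rw [Set.nonempty_iff_ne_empty]
  intro h
  rcases isClopen_iff.1 (isClopen_iff_frontier_eq_empty.2 h) with h | h
  · exact Set.eq_empty_iff_forall_notMem.1 h _ (natCast_mem_Bmu h1 hμ)
  · have h0 := (Set.eq_univ_iff_forall.1 h 0).2 ⟨0, by omega⟩ ⟨1, by omega⟩ (by simp)
    have : 0 < μ⁻¹ := by positivity
    simp only [Pi.zero_apply, sub_zero, norm_zero] at h0
    linarith

/-- On the boundary of `𝔅_μ` the potential grows at least linearly in `μ`. -/
theorem exists_mul_le_Vm_of_mem_frontier {N : ℕ} {m : Fin N → ℝ} (hm : ∀ j, 0 < m j) :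
    ∃ c > 0, ∀ μ ≥ 1, ∀ ζ ∈ frontier (Bmu N μ), c * μ ≤ Vm N m ζ := by
  obtain ⟨δ, hδ, hδm⟩ : ∃ δ > 0, ∀ j, δ ≤ m j := by
    rcases isEmpty_or_nonempty (Fin N) with _ | _
    · exact ⟨1, one_pos, fun j => isEmptyElim j⟩
    · obtain ⟨i, hi⟩ := Finite.exists_min m
      exact ⟨m i, hm i, hi⟩
  have h8 : 0 < 1 / (8 * Real.pi) := by positivity
  refine ⟨min (1 / 2 * δ) (1 / (8 * Real.pi) * (δ * δ)), by positivity, fun μ hμ ζ hζ => ?_⟩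
  have hμ0 : 0 ≤ μ := by linarith
  rcases norm_eq_of_mem_frontier_Bmu hζ with ⟨i, hi⟩ | ⟨i, j, hij, h⟩
  · calc _ ≤ 1 / 2 * δ * μ := mul_le_mul_of_nonneg_right (min_le_left _ _) hμ0
      _ ≤ 1 / 2 * m i * μ ^ 2 := by
        have := hδm i
        have := hm i
        gcongr
        nlinarith
      _ = 1 / 2 * (m i * ‖ζ i‖ ^ 2) := by rw [hi]; ring
      _ ≤ _ := confinement_le_Vm hm ζ i
  · calc _ ≤ 1 / (8 * Real.pi) * (δ * δ) * μ :=
          mul_le_mul_of_nonneg_right (min_le_right _ _) hμ0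
      _ ≤ 1 / (8 * Real.pi) * (m j * m i) * μ := by
        have := hδm i
        have := hδm j
        have := hm j
        gcongr
      _ = 1 / (8 * Real.pi) * (m j * m i / ‖ζ i - ζ j‖) := by rw [h, div_inv_eq_mul]; ring
      _ ≤ _ := interaction_le_Vm hm ζ hij.symm

/-- there exists `μ₀ > 0` such that for all `μ ≥ μ₀`, the infimum of `V_m`
over `𝔅_μ` is strictly smaller than its infimum over the boundary `∂𝔅_μ`. -/
theorem stmt5 (N : ℕ) (hN : 2 ≤ N) (m : Fin N → ℝ) (hm : ∀ j, 0 < m j) :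
    ∃ μ₀ > (0 : ℝ), ∀ μ ≥ μ₀,
      sInf (Vm N m '' Bmu N μ) < sInf (Vm N m '' frontier (Bmu N μ)) := by
  obtain ⟨c, hc, hV⟩ := exists_mul_le_Vm_of_mem_frontier hm
  set A := Vm N m (fun i : Fin N => ((i : ℕ) : ℂ))
  have hN' : (2 : ℝ) ≤ N := by exact_mod_cast hN
  have hA : 0 ≤ A := Vm_nonneg hm _
  have hAc : 0 ≤ (A + 1) / c := by positivity
  refine ⟨N + (A + 1) / c, by positivity, fun μ hμ => ?_⟩
  have h1 : 1 < μ := by linarith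
  have hNμ : (N : ℝ) ≤ μ := by linarith
  have hlt : A < c * μ := by
    have : A + 1 ≤ μ * c := (div_le_iff₀ hc).1 (by linarith)
    linarith
  calc sInf (Vm N m '' Bmu N μ) ≤ A :=
        csInf_le ⟨0, by rintro _ ⟨ζ, -, rfl⟩; exact Vm_nonneg hm ζ⟩
          ⟨_, natCast_mem_Bmu h1 hNμ, rfl⟩
    _ < c * μ := hlt
    _ ≤ _ := by
      refine le_csInf ((frontier_Bmu_nonempty hN h1 hNμ).image _) ?_
      rintro _ ⟨ζ, hζ, rfl⟩
      exact hV μ h1.le ζ hζ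
end

section
/- Fix a real exponent p with 3/2 < p < 5. The basic cell problem −Δw = (w−1)₊^p in ℝ³ with lim_{|x|→∞} w(x) = 0 has a solution w ∈ C²(ℝ³) which is positive and radially symmetric about some point, and this solution is unique up to translations: any two solutions (positive, C², tending to 0 at infinity) differ by a translation of ℝ³. -/
open MeasureTheory Filter

/-- The Laplacian on `ℝ³` (Euclidean space), as the sum of second partial derivatives. -/
noncomputable def lap (f : EuclideanSpace ℝ (Fin 3) → ℝ) (x : EuclideanSpace ℝ (Fin 3)) : ℝ :=
  ∑ i : Fin 3,
    iteratedFDeriv ℝ 2 f x ![EuclideanSpace.single i 1, EuclideanSpace.single i 1]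

/-- A solution of the basic cell problem: `w ∈ C²(ℝ³)`, `−Δw = (w−1)₊^p` in `ℝ³`,
and `w(x) → 0` as `|x| → ∞`. -/
def IsCellSolution (p : ℝ) (w : EuclideanSpace ℝ (Fin 3) → ℝ) : Prop :=
  ContDiff ℝ 2 w ∧ (∀ x, - lap w x = (max (w x - 1) 0) ^ p) ∧
    Tendsto w (cocompact (EuclideanSpace ℝ (Fin 3))) (nhds 0)

section CellProblem

open Set Metric Topology

/-- Three-dimensional Euclidean space. -/
abbrev E3 : Type := EuclideanSpace ℝ (Fin 3)

/-- The inner product of `E3` as a continuous bilinear map. -/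
noncomputable def innerCLM : E3 →L[ℝ] E3 →L[ℝ] ℝ := innerSL ℝ

@[simp] theorem innerCLM_apply (x y : E3) : innerCLM x y = inner ℝ x y := rfl

theorem lap_eq_sum_fderiv (f : E3 → ℝ) (x : E3) :
    lap f x = ∑ i : Fin 3, fderiv ℝ (fderiv ℝ f) x (EuclideanSpace.single i 1)
      (EuclideanSpace.single i 1) := by
  simp [lap, iteratedFDeriv_two_apply]

theorem lap_eq_laplacian (f : E3 → ℝ) : lap f = Laplacian.laplacian f := by
  rw [InnerProductSpace.laplacian_eq_iteratedFDeriv_orthonormalBasis f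
    (EuclideanSpace.basisFun (Fin 3) ℝ)]
  ext x
  simp [lap]

theorem lap_sub {f g : E3 → ℝ} {x : E3} (hf : ContDiffAt ℝ 2 f x) (hg : ContDiffAt ℝ 2 g x) :
    lap (fun y => f y - g y) x = lap f x - lap g x := by
  simp only [lap_eq_laplacian]
  exact hf.laplacian_sub hg

theorem lap_const_mul {f : E3 → ℝ} {x : E3} (a : ℝ) (hf : ContDiffAt ℝ 2 f x) :
    lap (fun y => a * f y) x = a * lap f x := by
  simp only [lap_eq_laplacian]
  exact InnerProductSpace.laplacian_smul a hf

theorem lap_neg (f : E3 → ℝ) (x : E3) : lap (fun y => - f y) x = - lap f x := by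
  simp only [lap_eq_laplacian]
  exact congrFun (InnerProductSpace.laplacian_neg (f := f)) x

theorem lap_comp_isometry {f : E3 → ℝ} (hf : ContDiff ℝ 2 f) (g : E3 ≃ₗᵢ[ℝ] E3) (a x : E3) :
    lap (fun y => f (g y + a)) x = lap f (g x + a) := by
  have hfa : ContDiff ℝ 2 (fun y => f (y + a)) := hf.comp (contDiff_id.add contDiff_const)
  have key : lap (fun y => f (y + a)) (g x) = lap f (g x + a) := by
    simp only [lap, iteratedFDeriv_comp_add_right]
  rw [← key, lap_eq_laplacian (fun y => f (y + a)),
    InnerProductSpace.laplacian_eq_iteratedFDeriv_orthonormalBasis _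
      ((EuclideanSpace.basisFun (Fin 3) ℝ).map g), lap]
  refine Finset.sum_congr rfl fun i _ => ?_
  have := ContinuousLinearMap.iteratedFDeriv_comp_right (𝕜 := ℝ) (g : E3 →L[ℝ] E3) hfa x
    (i := 2) le_rfl
  change iteratedFDeriv ℝ 2 ((fun y => f (y + a)) ∘ (g : E3 →L[ℝ] E3)) x _ = _
  rw [this, ContinuousMultilinearMap.compContinuousLinearMap_apply]
  congr 1
  ext j : 1
  fin_cases j <;> simp

theorem lap_comp_add_right (f : E3 → ℝ) (a x : E3) :
    lap (fun y => f (y + a)) x = lap f (x + a) := by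
  simp only [lap, iteratedFDeriv_comp_add_right]

/-- The Hessian is positive semidefinite at a local minimum. -/
theorem fderiv_fderiv_nonneg_of_isLocalMin {f : E3 → ℝ} {x : E3} (hf : ContDiffAt ℝ 2 f x)
    (hmin : IsLocalMin f x) (e : E3) : 0 ≤ fderiv ℝ (fderiv ℝ f) x e e := by
  have hline : ∀ s : ℝ, HasDerivAt (fun s : ℝ => x + s • e) e s := fun s => by
    simpa using ((hasDerivAt_id s).smul_const e).const_add x
  have hcont : Tendsto (fun s : ℝ => x + s • e) (𝓝 0) (𝓝 x) := by
    simpa using (hline 0).continuousAt.tendsto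
  have hd1 : ∀ᶠ s in 𝓝 (0 : ℝ), HasDerivAt (fun s : ℝ => f (x + s • e))
      (fderiv ℝ f (x + s • e) e) s := by
    have h1 : ∀ᶠ y in 𝓝 x, ContDiffAt ℝ 2 f y := hf.eventually (by simp)
    filter_upwards [hcont.eventually h1] with s hs
    exact (hs.differentiableAt (by norm_num)).hasFDerivAt.comp_hasDerivAt s (hline s)
  have hd2 : HasDerivAt (fun s : ℝ => fderiv ℝ f (x + s • e) e)
      (fderiv ℝ (fderiv ℝ f) x e e) 0 := by
    have h2 : DifferentiableAt ℝ (fderiv ℝ f) x :=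
      (hf.fderiv_right (m := 1) (by norm_num)).differentiableAt (by norm_num)
    have h2' : HasFDerivAt (fderiv ℝ f) (fderiv ℝ (fderiv ℝ f) x) (x + (0 : ℝ) • e) := by
      simpa using h2.hasFDerivAt
    have h3 := h2'.comp_hasDerivAt (0 : ℝ) (hline 0)
    simpa using h3.clm_apply (hasDerivAt_const (0 : ℝ) e)
  have hderiv : deriv (fun s : ℝ => f (x + s • e)) =ᶠ[𝓝 0]
      fun s => fderiv ℝ f (x + s • e) e := hd1.mono fun s hs => hs.deriv
  have hmin1 : IsLocalMin (fun s : ℝ => f (x + s • e)) 0 := by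
    have := hcont.eventually hmin
    simpa [IsLocalMin, IsMinFilter] using this
  have hzero : deriv (fun s : ℝ => f (x + s • e)) 0 = 0 := hmin1.deriv_eq_zero
  by_contra! hneg
  have hdd : deriv (deriv (fun s : ℝ => f (x + s • e))) 0 < 0 := by
    rw [hderiv.deriv_eq, hd2.deriv]; exact hneg
  have hmax := isLocalMax_of_deriv_deriv_neg hdd hzero hd1.self_of_nhds.continuousAt
  have hconst : (fun s : ℝ => f (x + s • e)) =ᶠ[𝓝 0] fun _ => f (x + (0 : ℝ) • e) := by
    filter_upwards [hmin1, hmax] with s h1 h2 using le_antisymm h2 h1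
  have : deriv (deriv (fun s : ℝ => f (x + s • e))) 0 = 0 := by
    rw [hconst.deriv.deriv_eq]; simp
  linarith

theorem lap_nonneg_of_isLocalMin {f : E3 → ℝ} {x : E3} (hf : ContDiffAt ℝ 2 f x)
    (hmin : IsLocalMin f x) : 0 ≤ lap f x := by
  rw [lap_eq_sum_fderiv]
  exact Finset.sum_nonneg fun i _ => fderiv_fderiv_nonneg_of_isLocalMin hf hmin _

theorem lap_norm_sq (x : E3) : lap (fun y : E3 => ‖y‖ ^ 2) x = 6 := by
  have h1 : fderiv ℝ (fun y : E3 => ‖y‖ ^ 2) = fun y => 2 • innerCLM y := by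
    ext1 y
    exact (hasStrictFDerivAt_norm_sq y).hasFDerivAt.fderiv
  have h2 : fderiv ℝ (fun y : E3 => 2 • innerCLM y) x = 2 • innerCLM := by
    exact (innerCLM.hasFDerivAt.const_smul 2).fderiv
  rw [lap_eq_sum_fderiv, h1, h2]
  simp
  norm_num

/-- Weak minimum principle on a compact set. -/
theorem le_of_lap_nonpos {K : Set E3} (hK : IsCompact K) {v : E3 → ℝ} (hv : ContinuousOn v K)
    {m : ℝ} (h : ∀ x ∈ K, m ≤ v x ∨ (K ∈ 𝓝 x ∧ ContDiffAt ℝ 2 v x ∧ lap v x ≤ 0)) :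
    ∀ x ∈ K, m ≤ v x := by
  intro x₀ hx₀
  by_contra! hlt
  obtain ⟨B, hBpos, hB⟩ := hK.isBounded.exists_pos_norm_le
  set ε := (m - v x₀) / (2 * B ^ 2) with hε
  have hεpos : 0 < ε := div_pos (by linarith) (by positivity)
  have hεB : ε * B ^ 2 = (m - v x₀) / 2 := by rw [hε]; field_simp
  have hcont : ContinuousOn (fun x => v x - ε * ‖x‖ ^ 2) K :=
    hv.sub (by fun_prop)
  obtain ⟨z, hzK, hz⟩ := hK.exists_isMinOn ⟨x₀, hx₀⟩ hcont
  have hz0 : v z - ε * ‖z‖ ^ 2 ≤ v x₀ - ε * ‖x₀‖ ^ 2 := hz hx₀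
  have hzB : ‖z‖ ^ 2 ≤ B ^ 2 := pow_le_pow_left₀ (norm_nonneg _) (hB z hzK) 2
  have hvz : v z < m := by
    have h1 : ε * ‖z‖ ^ 2 ≤ ε * B ^ 2 := by gcongr
    have h2 : 0 ≤ ε * ‖x₀‖ ^ 2 := by positivity
    linarith
  rcases h z hzK with h1 | ⟨hKz, hsm, hlap⟩
  · linarith
  · have hsq : ContDiffAt ℝ 2 (fun y : E3 => ‖y‖ ^ 2) z := (contDiff_norm_sq ℝ).contDiffAt
    have hsm2 : ContDiffAt ℝ 2 (fun x => v x - ε * ‖x‖ ^ 2) z :=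
      hsm.sub (contDiffAt_const.mul hsq)
    have hnn := lap_nonneg_of_isLocalMin hsm2 (hz.isLocalMin hKz)
    rw [lap_sub hsm (contDiffAt_const.mul hsq), lap_const_mul ε hsq, lap_norm_sq] at hnn
    linarith

/-- Weak minimum principle on a closed set, for functions vanishing at infinity. -/
theorem le_of_lap_nonpos_of_tendsto {S : Set E3} (hS : IsClosed S) {v : E3 → ℝ}
    (hv : ContinuousOn v S) (hlim : Tendsto v (cocompact E3) (𝓝 0)) {m : ℝ} (hm : m ≤ 0)
    (h : ∀ x ∈ S, m ≤ v x ∨ (S ∈ 𝓝 x ∧ ContDiffAt ℝ 2 v x ∧ lap v x ≤ 0)) :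
    ∀ x ∈ S, m ≤ v x := by
  intro x hx
  refine le_of_forall_lt fun m' hm' => ?_
  obtain ⟨m'', h1, h2⟩ := exists_between hm'
  refine h1.trans_le ?_
  have hev : ∀ᶠ y in cocompact E3, m'' ≤ v y :=
    hlim.eventually (eventually_ge_nhds (h2.trans_le hm))
  obtain ⟨R, hR⟩ : ∃ R, ∀ y : E3, R ≤ ‖y‖ → m'' ≤ v y := by
    rw [← Metric.cobounded_eq_cocompact, ← comap_norm_atTop] at hev
    obtain ⟨s, hs, hs'⟩ := hev
    obtain ⟨R, hR⟩ := mem_atTop_sets.1 hs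
    exact ⟨R, fun y hy => hs' (hR _ hy)⟩
  have hK : IsCompact (S ∩ closedBall (0 : E3) (max R ‖x‖)) :=
    (isCompact_closedBall _ _).inter_left hS
  refine le_of_lap_nonpos hK (hv.mono inter_subset_left) (fun y hy => ?_) x ⟨hx, by simp⟩
  by_cases hy1 : m'' ≤ v y
  · exact Or.inl hy1
  · right
    have hyR : ‖y‖ < R := by
      by_contra! hc
      exact hy1 (hR y hc)
    rcases h y hy.1 with h3 | ⟨h3, h4⟩
    · exact absurd (h2.le.trans h3) hy1
    · refine ⟨inter_mem h3 (mem_of_superset (isOpen_ball.mem_nhds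
        (mem_ball_zero_iff.2 (hyR.trans_le (le_max_left _ _)))) ball_subset_closedBall), h4⟩

theorem hasFDerivAt_norm_euclidean {x : E3} (hx : x ≠ 0) :
    HasFDerivAt (fun y : E3 => ‖y‖) (‖x‖⁻¹ • innerCLM x) x := by
  have hx' : 0 < ‖x‖ := norm_pos_iff.2 hx
  have h := (hasStrictFDerivAt_norm_sq x).hasFDerivAt.sqrt (by positivity)
  simp only [Real.sqrt_sq (norm_nonneg _)] at h
  refine h.congr_fderiv ?_
  ext y
  simp
  field_simp

theorem hasFDerivAt_radial {φ : ℝ → ℝ} {d : ℝ} {x : E3} (hx : x ≠ 0)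
    (h : HasDerivAt φ (‖x‖ * d) ‖x‖) :
    HasFDerivAt (fun y : E3 => φ ‖y‖) (d • innerCLM x) x := by
  have h1 := h.comp_hasFDerivAt x (hasFDerivAt_norm_euclidean hx)
  have hx' : ‖x‖ ≠ 0 := norm_ne_zero_iff.2 hx
  refine h1.congr_fderiv ?_
  rw [smul_smul]
  congr 1
  field_simp

theorem hasFDerivAt_smul_innerSL {ψ : ℝ → ℝ} {c : ℝ} {x : E3} (hx : x ≠ 0)
    (h : HasDerivAt ψ (‖x‖ * c) ‖x‖) :
    HasFDerivAt (fun y : E3 => ψ ‖y‖ • innerCLM y)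
      (ψ ‖x‖ • innerCLM + (c • innerCLM x).smulRight (innerCLM x)) x :=
  (hasFDerivAt_radial hx h).smul innerCLM.hasFDerivAt

theorem fderiv_fderiv_radial {φ ψ : ℝ → ℝ} {c : ℝ} {x : E3} (hx : x ≠ 0)
    (h1 : ∀ᶠ t in 𝓝 ‖x‖, HasDerivAt φ (t * ψ t) t) (h2 : HasDerivAt ψ (‖x‖ * c) ‖x‖) :
    fderiv ℝ (fderiv ℝ fun y : E3 => φ ‖y‖) x =
      ψ ‖x‖ • innerCLM + (c • innerCLM x).smulRight (innerCLM x) := by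
  have h3 : fderiv ℝ (fun y : E3 => φ ‖y‖) =ᶠ[𝓝 x] fun y => ψ ‖y‖ • innerCLM y := by
    filter_upwards [continuous_norm.continuousAt.eventually h1,
      isOpen_ne.mem_nhds hx] with y hy hy0
    exact (hasFDerivAt_radial hy0 hy).fderiv
  rw [h3.fderiv_eq, (hasFDerivAt_smul_innerSL hx h2).fderiv]

theorem sum_hessian_radial (a c : ℝ) (x : E3) :
    ∑ i : Fin 3, (a • innerCLM + (c • innerCLM x).smulRight (innerCLM x) :
      E3 →L[ℝ] E3 →L[ℝ] ℝ) (EuclideanSpace.single i 1) (EuclideanSpace.single i 1) =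
      3 * a + ‖x‖ ^ 2 * c := by
  rw [EuclideanSpace.norm_sq_eq]
  simp [Fin.sum_univ_three, EuclideanSpace.inner_single_right]
  ring

theorem lap_radial {φ ψ : ℝ → ℝ} {c : ℝ} {x : E3} (hx : x ≠ 0)
    (h1 : ∀ᶠ t in 𝓝 ‖x‖, HasDerivAt φ (t * ψ t) t) (h2 : HasDerivAt ψ (‖x‖ * c) ‖x‖) :
    lap (fun y : E3 => φ ‖y‖) x = 3 * ψ ‖x‖ + ‖x‖ ^ 2 * c := by
  rw [lap_eq_sum_fderiv, fderiv_fderiv_radial hx h1 h2, sum_hessian_radial]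

theorem lap_inv_norm {x : E3} (hx : x ≠ 0) : lap (fun y : E3 => ‖y‖⁻¹) x = 0 := by
  have hpos : 0 < ‖x‖ := norm_pos_iff.2 hx
  rw [lap_radial (φ := fun t => t⁻¹) (ψ := fun t => - (t ^ 3)⁻¹) (c := 3 * (‖x‖ ^ 5)⁻¹) hx]
  · field_simp
    ring
  · filter_upwards [eventually_gt_nhds hpos] with t ht
    refine (hasDerivAt_inv ht.ne').congr_deriv ?_
    field_simp
  · refine ((hasDerivAt_pow 3 ‖x‖).fun_inv (by positivity)).fun_neg.congr_deriv ?_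
    field_simp
    norm_num
    ring

theorem lap_inv_norm_sub {x c : E3} (hx : x ≠ c) : lap (fun y : E3 => ‖y - c‖⁻¹) x = 0 := by
  have := lap_comp_add_right (fun y : E3 => ‖y‖⁻¹) (-c) x
  simp only [← sub_eq_add_neg] at this
  rw [this, lap_inv_norm (sub_ne_zero.2 hx)]

/-- Comparison of a nonnegative superharmonic function with a Newtonian potential on an annulus. -/
theorem exists_newtonian_lower_bound {v : E3 → ℝ} {c : E3} {δ R : ℝ} (hδ : 0 < δ) (hδR : δ < R)
    (hv : ContDiff ℝ 2 v) (hlap : ∀ x ∈ ball c R, lap v x ≤ 0)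
    (hnn : ∀ x ∈ closedBall c R, 0 ≤ v x) (hpos : ∀ x ∈ closedBall c δ, 0 < v x) :
    ∃ ε > 0, ∀ x ∈ closedBall c R, δ ≤ ‖x - c‖ → ε * (‖x - c‖⁻¹ - R⁻¹) ≤ v x := by
  obtain ⟨z, hz, hzmin⟩ := (isCompact_closedBall c δ).exists_isMinOn
    ⟨c, mem_closedBall_self hδ.le⟩ hv.continuous.continuousOn
  have hR : 0 < R := hδ.trans hδR
  refine ⟨v z * δ, mul_pos (hpos z hz) hδ, fun x hx hxδ => ?_⟩
  set K : Set E3 := closedBall c R ∩ {y | δ ≤ ‖y - c‖} with hK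
  have hKc : IsCompact K := (isCompact_closedBall c R).inter_right
    (isClosed_le continuous_const (by fun_prop))
  have hne : ∀ y ∈ K, y ≠ c := by
    rintro y hy rfl
    have := hy.2
    simp at this
    linarith
  have hsm : ∀ y ∈ K, ContDiffAt ℝ 2 (fun y : E3 => ‖y - c‖⁻¹ - R⁻¹) y := fun y hy => by
    have h0 : y - c ≠ 0 := sub_ne_zero.2 (hne y hy)
    exact (((contDiffAt_id.sub contDiffAt_const).norm ℝ h0).inv (norm_ne_zero_iff.2 h0)).sub
      contDiffAt_const
  have hcont : ContinuousOn (fun y => v y - v z * δ * (‖y - c‖⁻¹ - R⁻¹)) K := fun y hy =>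
    (hv.continuous.continuousAt.sub
      (continuousAt_const.mul (hsm y hy).continuousAt)).continuousWithinAt
  have := le_of_lap_nonpos hKc hcont (m := 0) (fun y hy => ?_) x ⟨hx, hxδ⟩
  · linarith
  have hyR : ‖y - c‖ ≤ R := by simpa [dist_eq_norm] using hy.1
  rcases hyR.eq_or_lt with h1 | h1
  · left
    rw [h1]
    simpa using hnn y hy.1
  have hyδ : δ ≤ ‖y - c‖ := hy.2
  rcases hyδ.eq_or_lt with h2 | h2
  · left
    have hy' : y ∈ closedBall c δ := by simp [dist_eq_norm, ← h2]
    have h3 : v z ≤ v y := hzmin hy'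
    rw [← h2]
    have h4 : v z * δ * (δ⁻¹ - R⁻¹) = v z - v z * δ * R⁻¹ := by field_simp
    have h5 : 0 ≤ v z * δ * R⁻¹ := by have := hpos z hz; positivity
    rw [h4]
    linarith
  · right
    refine ⟨inter_mem (mem_of_superset (isOpen_ball.mem_nhds ?_) ball_subset_closedBall)
      (mem_of_superset ((isOpen_lt continuous_const (by fun_prop :
        Continuous fun y : E3 => ‖y - c‖)).mem_nhds h2) fun y (hy : δ < ‖y - c‖) => hy.le),
      hv.contDiffAt.sub (contDiffAt_const.mul (hsm y hy)), ?_⟩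
    · simpa [dist_eq_norm] using h1
    · have h6 : lap (fun y : E3 => ‖y - c‖⁻¹ - R⁻¹) y = 0 := by
        have h0 : y - c ≠ 0 := sub_ne_zero.2 (hne y hy)
        have hinv : ContDiffAt ℝ 2 (fun y : E3 => ‖y - c‖⁻¹) y :=
          ((contDiffAt_id.sub contDiffAt_const).norm ℝ h0).inv (norm_ne_zero_iff.2 h0)
        rw [lap_sub hinv contDiffAt_const, lap_inv_norm_sub (hne y hy), lap_eq_laplacian]
        simp
      rw [lap_sub hv.contDiffAt (contDiffAt_const.mul (hsm y hy)), lap_const_mul _ (hsm y hy), h6]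
      have := hlap y (by simpa [dist_eq_norm] using h1)
      linarith

theorem inner_sub_norm_le {e : E3} (he : ‖e‖ = 1) (x c : E3) :
    inner ℝ e c - ‖x - c‖ ≤ inner ℝ e x := by
  have h := abs_real_inner_le_norm e (x - c)
  rw [he, one_mul, inner_sub_right] at h
  linarith [(abs_le.1 h).1]

theorem pos_of_norm_sub_lt {v : E3 → ℝ} (hv : ContDiff ℝ 2 v) {e : E3} (he : ‖e‖ = 1) {l : ℝ}
    (hlap : ∀ x, l < inner ℝ e x → lap v x ≤ 0) (hnn : ∀ x, l ≤ inner ℝ e x → 0 ≤ v x)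
    {c x : E3} (hvc : 0 < v c) (hx : ‖x - c‖ < inner ℝ e c - l) : 0 < v x := by
  obtain ⟨R, hxR, hR⟩ := exists_between hx
  have hRpos : 0 < R := (norm_nonneg _).trans_lt hxR
  obtain ⟨δ₀, hδ₀, hball⟩ := Metric.nhds_basis_closedBall.mem_iff.1
    (hv.continuous.continuousAt.eventually (eventually_gt_nhds hvc))
  set δ := min δ₀ (R / 2) with hδ
  have hδpos : 0 < δ := lt_min hδ₀ (by linarith)
  have hδR : δ < R := (min_le_right _ _).trans_lt (by linarith)
  have hpos : ∀ y ∈ closedBall c δ, 0 < v y := fun y hy =>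
    hball (closedBall_subset_closedBall (min_le_left _ _) hy)
  obtain ⟨ε, hε, hb⟩ := exists_newtonian_lower_bound hδpos hδR hv
    (fun y hy => hlap y (by
      have h1 := inner_sub_norm_le he y c
      have h2 : ‖y - c‖ < R := by simpa [dist_eq_norm] using hy
      linarith))
    (fun y hy => hnn y (by
      have h1 := inner_sub_norm_le he y c
      have h2 : ‖y - c‖ ≤ R := by simpa [dist_eq_norm] using hy
      linarith)) hpos
  rcases le_or_gt ‖x - c‖ δ with h | h
  · exact hpos x (by simpa [dist_eq_norm] using h)
  · refine lt_of_lt_of_le (mul_pos hε (sub_pos.2 ?_))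
      (hb x (by simpa [dist_eq_norm] using hxR.le) h.le)
    exact inv_strictAnti₀ (hδpos.trans h) hxR

/-- Strong minimum principle in a half-space. -/
theorem pos_of_lap_nonpos_halfspace {v : E3 → ℝ} (hv : ContDiff ℝ 2 v) {e : E3} (he : ‖e‖ = 1)
    {l : ℝ} (hlap : ∀ x, l < inner ℝ e x → lap v x ≤ 0) (hnn : ∀ x, l ≤ inner ℝ e x → 0 ≤ v x)
    {c : E3} (hc : l < inner ℝ e c) (hvc : 0 < v c) : ∀ x, l < inner ℝ e x → 0 < v x := by
  have hopen : IsOpen {x : E3 | l < inner ℝ e x} := isOpen_lt continuous_const (by fun_prop)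
  have hconv : Convex ℝ {x : E3 | l < inner ℝ e x} :=
    convex_halfSpace_gt (innerCLM e).toLinearMap.isLinear l
  have hsub := hconv.isPreconnected.subset_of_closure_inter_subset
    (u := {x : E3 | l < inner ℝ e x} ∩ {x | 0 < v x})
    (hopen.inter (isOpen_lt continuous_const hv.continuous)) ⟨c, hc, hc, hvc⟩ (by
      rintro x ⟨hxcl, hx⟩
      refine ⟨hx, ?_⟩
      have hx' : l < inner ℝ e x := hx
      obtain ⟨d, ⟨hd1, hd2⟩, hd⟩ := Metric.mem_closure_iff.1 hxcl ((inner ℝ e x - l) / 2)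
        (by linarith)
      rw [dist_eq_norm] at hd
      have h1 := inner_sub_norm_le he d x
      rw [norm_sub_rev] at h1
      exact pos_of_norm_sub_lt hv he hlap hnn (c := d) hd2 (by linarith))
  exact fun x hx => (hsub hx).2

/-- Hopf boundary point estimate in a half-space. -/
theorem exists_linear_lower_bound {v : E3 → ℝ} (hv : ContDiff ℝ 2 v) {e : E3} (he : ‖e‖ = 1)
    {l : ℝ} (hlap : ∀ x, l < inner ℝ e x → lap v x ≤ 0) (hnn : ∀ x, l ≤ inner ℝ e x → 0 ≤ v x)
    (hpos : ∀ x, l < inner ℝ e x → 0 < v x) {z : E3} (hz : inner ℝ e z = l) :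
    ∃ ε > 0, ∀ t : ℝ, 0 < t → t ≤ 1 / 2 → ε * t ≤ v (z + t • e) := by
  have hce : inner ℝ e (z + e) = l + 1 := by
    rw [inner_add_right, hz, real_inner_self_eq_norm_sq, he]; norm_num
  obtain ⟨ε, hε, hb⟩ := exists_newtonian_lower_bound (c := z + e) (δ := 1 / 2) (R := 1)
    (by norm_num) (by norm_num) hv
    (fun y hy => hlap y (by
      have h1 := inner_sub_norm_le he y (z + e)
      have h2 : ‖y - (z + e)‖ < 1 := by simpa [dist_eq_norm] using hy
      linarith))
    (fun y hy => hnn y (by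
      have h1 := inner_sub_norm_le he y (z + e)
      have h2 : ‖y - (z + e)‖ ≤ 1 := by simpa [dist_eq_norm] using hy
      linarith))
    (fun y hy => hpos y (by
      have h1 := inner_sub_norm_le he y (z + e)
      have h2 : ‖y - (z + e)‖ ≤ 1 / 2 := by simpa [dist_eq_norm] using hy
      linarith))
  refine ⟨ε, hε, fun t ht ht2 => ?_⟩
  have hn : ‖z + t • e - (z + e)‖ = 1 - t := by
    have : z + t • e - (z + e) = (t - 1) • e := by module
    rw [this, norm_smul, he, Real.norm_eq_abs, abs_of_nonpos (by linarith)]; ring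
  have := hb (z + t • e) (by rw [mem_closedBall, dist_eq_norm, hn]; linarith)
    (by rw [hn]; linarith)
  rw [hn] at this
  refine le_trans (mul_le_mul_of_nonneg_left ?_ hε.le) this
  have h1 : 0 < 1 - t := by linarith
  rw [inv_one, le_sub_iff_add_le, ← one_div, le_div_iff₀ h1]
  nlinarith

/-- Reflection across the plane `⟪e, x⟫ = l`, for a unit vector `e`. -/
noncomputable def planeRefl (e : E3) (l : ℝ) (x : E3) : E3 := x - (2 * (inner ℝ e x - l)) • e

theorem planeRefl_eq {e : E3} (he : ‖e‖ = 1) (l : ℝ) (x : E3) :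
    planeRefl e l x = (ℝ ∙ e)ᗮ.reflection x + (2 * l) • e := by
  rw [Submodule.reflection_orthogonal_apply, Submodule.reflection_singleton_apply, planeRefl, he]
  simp
  module

theorem inner_planeRefl {e : E3} (he : ‖e‖ = 1) (l : ℝ) (x : E3) :
    inner ℝ e (planeRefl e l x) = 2 * l - inner ℝ e x := by
  rw [planeRefl, inner_sub_right, inner_smul_right, real_inner_self_eq_norm_sq, he]; ring

theorem planeRefl_planeRefl {e : E3} (he : ‖e‖ = 1) (l : ℝ) (x : E3) :
    planeRefl e l (planeRefl e l x) = x := by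
  rw [planeRefl, inner_planeRefl he, planeRefl]; module

theorem planeRefl_of_mem {e x : E3} {l : ℝ} (hx : inner ℝ e x = l) : planeRefl e l x = x := by
  simp [planeRefl, hx]

theorem planeRefl_add_smul {e : E3} (he : ‖e‖ = 1) (l : ℝ) (x : E3) (s : ℝ) :
    planeRefl e l (x + s • e) = planeRefl e l x + s • (-e) := by
  simp only [planeRefl, inner_add_right, inner_smul_right, real_inner_self_eq_norm_sq, he]
  module

theorem contDiff_planeRefl (e : E3) (l : ℝ) : ContDiff ℝ 2 (planeRefl e l) :=
  contDiff_id.sub ((contDiff_const.mul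
    ((contDiff_const.inner ℝ contDiff_id).sub contDiff_const)).smul contDiff_const)

theorem continuous_planeRefl_uncurry (e : E3) :
    Continuous fun q : ℝ × E3 => planeRefl e q.1 q.2 := by
  unfold planeRefl
  fun_prop

theorem tendsto_planeRefl_cocompact {e : E3} (he : ‖e‖ = 1) (l : ℝ) :
    Tendsto (planeRefl e l) (cocompact E3) (cocompact E3) := by
  have : planeRefl e l = (ℝ ∙ e)ᗮ.reflection.toHomeomorph.trans
      (Homeomorph.addRight ((2 * l) • e)) := by
    ext1 x
    simp [planeRefl_eq he]
  rw [this]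
  exact (Homeomorph.isClosedEmbedding _).tendsto_cocompact

theorem lap_comp_planeRefl {u : E3 → ℝ} (hu : ContDiff ℝ 2 u) {e : E3} (he : ‖e‖ = 1) (l : ℝ)
    (x : E3) : lap (fun y => u (planeRefl e l y)) x = lap u (planeRefl e l x) := by
  simp only [planeRefl_eq he]
  exact lap_comp_isometry hu _ _ x

/-- The difference between the reflection of `u` and `u`. -/
noncomputable def reflDiff (u : E3 → ℝ) (e : E3) (l : ℝ) (x : E3) : ℝ := u (planeRefl e l x) - u x

theorem IsCellSolution.lap_eq {p : ℝ} {u : E3 → ℝ} (hu : IsCellSolution p u) (x : E3) :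
    lap u x = -(max (u x - 1) 0) ^ p := by
  rw [← hu.2.1 x, neg_neg]

theorem contDiff_reflDiff {u : E3 → ℝ} (hu : ContDiff ℝ 2 u) (e : E3) (l : ℝ) :
    ContDiff ℝ 2 (reflDiff u e l) :=
  (hu.comp (contDiff_planeRefl e l)).sub hu

theorem tendsto_reflDiff {u : E3 → ℝ} (hu : Tendsto u (cocompact E3) (𝓝 0)) {e : E3}
    (he : ‖e‖ = 1) (l : ℝ) : Tendsto (reflDiff u e l) (cocompact E3) (𝓝 0) := by
  have := (hu.comp (tendsto_planeRefl_cocompact he l)).sub hu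
  rwa [sub_zero] at this

theorem reflDiff_of_mem (u : E3 → ℝ) {e x : E3} {l : ℝ} (hx : inner ℝ e x = l) :
    reflDiff u e l x = 0 := by
  simp [reflDiff, planeRefl_of_mem hx]

theorem lap_reflDiff_nonpos {p : ℝ} (hp : 0 < p) {u : E3 → ℝ} (hu : IsCellSolution p u) {e : E3}
    (he : ‖e‖ = 1) {l : ℝ} {x : E3} (h : 0 ≤ reflDiff u e l x ∨ u x ≤ 1) :
    lap (reflDiff u e l) x ≤ 0 := by
  have h1 : lap (reflDiff u e l) x = lap u (planeRefl e l x) - lap u x := by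
    rw [← lap_comp_planeRefl hu.1 he]
    exact lap_sub (hu.1.comp (contDiff_planeRefl e l)).contDiffAt hu.1.contDiffAt
  rw [h1, hu.lap_eq, hu.lap_eq]
  have h2 : (max (u x - 1) 0) ^ p ≤ (max (u (planeRefl e l x) - 1) 0) ^ p := by
    refine Real.rpow_le_rpow (le_max_right _ _) ?_ hp.le
    rcases h with h | h
    · unfold reflDiff at h
      exact max_le_max (by linarith) le_rfl
    · rw [max_eq_right (by linarith)]
      exact le_max_right _ _
  linarith

theorem le_reflDiff {p : ℝ} (hp : 0 < p) {u : E3 → ℝ} (hu : IsCellSolution p u) {e : E3}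
    (he : ‖e‖ = 1) {l m : ℝ} (hm : m ≤ 0)
    (h : ∀ x, l ≤ inner ℝ e x → 1 ≤ u x → m ≤ reflDiff u e l x) :
    ∀ x, l ≤ inner ℝ e x → m ≤ reflDiff u e l x := by
  have hcd := contDiff_reflDiff hu.1 e l
  refine le_of_lap_nonpos_of_tendsto (S := {x : E3 | l ≤ inner ℝ e x})
    (isClosed_le continuous_const (by fun_prop)) hcd.continuous.continuousOn
    (tendsto_reflDiff hu.2.2 he l) hm fun x hx => ?_
  rcases (show l ≤ inner ℝ e x from hx).eq_or_lt with h1 | h1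
  · left
    rwa [reflDiff_of_mem u h1.symm]
  rcases le_or_gt 1 (u x) with h2 | h2
  · exact Or.inl (h x hx h2)
  · exact Or.inr ⟨mem_of_superset ((isOpen_lt continuous_const (by fun_prop :
        Continuous fun y : E3 => (inner ℝ e y : ℝ))).mem_nhds h1) fun y (hy : l < inner ℝ e y) =>
          hy.le, hcd.contDiffAt, lap_reflDiff_nonpos hp hu he (Or.inr h2.le)⟩

theorem isCompact_one_le {u : E3 → ℝ} (hc : Continuous u) (hu : Tendsto u (cocompact E3) (𝓝 0)) :
    IsCompact {x | 1 ≤ u x} := by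
  obtain ⟨K, hK, hsub⟩ := mem_cocompact.1 (hu.eventually (eventually_lt_nhds zero_lt_one))
  refine hK.of_isClosed_subset (isClosed_le continuous_const hc) fun x hx => ?_
  by_contra hxK
  have : u x < 1 := hsub hxK
  exact absurd hx (not_le.2 this)

theorem hasDerivAt_reflDiff_line {u : E3 → ℝ} (hu : ContDiff ℝ 2 u) {e : E3}
    (he : ‖e‖ = 1) (l : ℝ) (z : E3) :
    HasDerivAt (fun s : ℝ => reflDiff u e l (z + s • e))
      (-(fderiv ℝ u (planeRefl e l z) e + fderiv ℝ u z e)) 0 := by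
  have hline : ∀ a b : E3, HasDerivAt (fun s : ℝ => u (a + s • b)) (fderiv ℝ u a b) 0 := by
    intro a b
    have h1 : HasDerivAt (fun s : ℝ => a + s • b) b 0 := by
      simpa using ((hasDerivAt_id (0 : ℝ)).smul_const b).const_add a
    have h2 : HasFDerivAt u (fderiv ℝ u a) (a + (0 : ℝ) • b) := by
      simpa using (hu.differentiable (by norm_num) a).hasFDerivAt
    exact h2.comp_hasDerivAt (0 : ℝ) h1
  have := (hline (planeRefl e l z) (-e)).sub (hline z e)
  simp only [reflDiff, planeRefl_add_smul he]
  exact this.congr_deriv (by rw [map_neg]; ring)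

theorem exists_reflDiff_neg_critical {p : ℝ} (hp : 0 < p) {u : E3 → ℝ} (hu : IsCellSolution p u)
    {e : E3} (he : ‖e‖ = 1) {l : ℝ} (h : ¬ ∀ x, l ≤ inner ℝ e x → 0 ≤ reflDiff u e l x) :
    ∃ z, l ≤ inner ℝ e z ∧ 1 ≤ u z ∧ reflDiff u e l z ≤ 0 ∧
      fderiv ℝ u (planeRefl e l z) e + fderiv ℝ u z e = 0 := by
  have hcd := contDiff_reflDiff hu.1 e l
  have h1 : ∃ x, l ≤ inner ℝ e x ∧ 1 ≤ u x ∧ reflDiff u e l x < 0 := by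
    by_contra! hcon
    exact h (le_reflDiff hp hu he le_rfl hcon)
  obtain ⟨x, hx1, hx2, hx3⟩ := h1
  have hK : IsCompact ({x : E3 | l ≤ inner ℝ e x} ∩ {x | 1 ≤ u x}) :=
    (isCompact_one_le hu.1.continuous hu.2.2).inter_left
      (isClosed_le continuous_const (by fun_prop))
  obtain ⟨z, ⟨hz1, hz2⟩, hzmin⟩ := hK.exists_isMinOn ⟨x, hx1, hx2⟩ hcd.continuous.continuousOn
  have hzneg : reflDiff u e l z < 0 := lt_of_le_of_lt (hzmin ⟨hx1, hx2⟩) hx3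
  have hmin := le_reflDiff hp hu he hzneg.le fun y hy1 hy2 => hzmin ⟨hy1, hy2⟩
  have hzl : l < inner ℝ e z := by
    refine lt_of_le_of_ne hz1 fun heq => ?_
    rw [reflDiff_of_mem u heq.symm] at hzneg
    exact hzneg.false
  refine ⟨z, hz1, hz2, hzneg.le, ?_⟩
  have hloc : IsLocalMin (fun s : ℝ => reflDiff u e l (z + s • e)) 0 := by
    have hcont : Continuous fun s : ℝ => (inner ℝ e (z + s • e) : ℝ) := by fun_prop
    have hev : ∀ᶠ s in 𝓝 (0 : ℝ), l < inner ℝ e (z + s • e) :=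
      hcont.continuousAt.eventually_const_lt (by simpa using hzl)
    filter_upwards [hev] with s hs
    simpa using hmin _ hs.le
  have := hloc.hasDerivAt_eq_zero (hasDerivAt_reflDiff_line hu.1 he l z)
  linarith

/-- By the method of moving planes, a positive solution has a plane of symmetry in every
direction. -/
theorem exists_symmetry_plane {p : ℝ} (hp : 0 < p) {u : E3 → ℝ} (hu : IsCellSolution p u)
    (hpos : ∀ x, 0 < u x) {e : E3} (he : ‖e‖ = 1) : ∃ l : ℝ, ∀ x, u (planeRefl e l x) = u x := by
  have hinner : ∀ x : E3, inner ℝ e x ≤ ‖x‖ := fun x => by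
    simpa [he] using real_inner_le_norm e x
  set A : Set ℝ := {l | ∀ x, l ≤ inner ℝ e x → 0 ≤ reflDiff u e l x} with hA
  have hAeq : A = {l | ∀ x : E3, 0 ≤ (inner ℝ e x : ℝ) →
      u (x + l • e) ≤ u (planeRefl e l (x + l • e))} := by
    ext l
    have hin : ∀ (x : E3) (t : ℝ), inner ℝ e (x + t • e) = inner ℝ e x + t := fun x t => by
      rw [inner_add_right, inner_smul_right, real_inner_self_eq_norm_sq, he]; ring
    refine ⟨fun h x hx => ?_, fun h x hx => ?_⟩
    · exact sub_nonneg.1 (h (x + l • e) (by rw [hin]; linarith))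
    · have := h (x + (-l) • e) (by rw [hin]; linarith)
      rw [show x + (-l) • e + l • e = x by module] at this
      exact sub_nonneg.2 this
  have hclosed : IsClosed A := by
    rw [hAeq]
    simp only [ofPred_forall]
    refine isClosed_iInter fun x => isClosed_iInter fun _ => isClosed_le
      (hu.1.continuous.comp (by fun_prop)) (hu.1.continuous.comp ?_)
    exact (continuous_planeRefl_uncurry e).comp
      (by fun_prop : Continuous fun l : ℝ => (l, x + l • e))
  have hne : A.Nonempty := by
    obtain ⟨B, hB⟩ := (isCompact_one_le hu.1.continuous hu.2.2).isBounded.exists_norm_le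
    refine ⟨B + 1, le_reflDiff hp hu he le_rfl fun x hx1 hx2 => ?_⟩
    have := hB x hx2
    linarith [hinner x]
  have hnuniv : A ≠ univ := by
    intro huniv
    have h1 : ∀ n : ℕ, u 0 ≤ u ((-(2 * (n : ℝ))) • e) := fun n => by
      have h2 : (-(n : ℝ)) ∈ A := huniv ▸ mem_univ _
      have h3 := h2 0 (by simp)
      simpa [reflDiff, planeRefl] using h3
    have h4 : Tendsto (fun n : ℕ => (-(2 * (n : ℝ))) • e) atTop (cocompact E3) := by
      refine tendsto_norm_atTop_iff_cobounded.1 ?_ |>.mono_right ?_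
      · simp only [norm_smul, he, norm_neg, norm_mul, Real.norm_natCast, mul_one]
        exact tendsto_natCast_atTop_atTop.const_mul_atTop (by norm_num)
      · rw [Metric.cobounded_eq_cocompact]
    exact absurd (ge_of_tendsto' (hu.2.2.comp h4) h1) (not_le.2 (hpos 0))
  have hmu : ∃ μ ∈ A, μ ∈ closure Aᶜ := by
    by_contra! hcon
    have hopen : IsOpen A := by
      rw [isOpen_iff_mem_nhds]
      intro μ hμ
      by_contra hn
      exact hcon μ hμ (by rwa [closure_compl, mem_compl_iff, mem_interior_iff_mem_nhds])
    rcases isClopen_iff.1 ⟨hclosed, hopen⟩ with h | h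
    · exact hne.ne_empty h
    · exact hnuniv h
  obtain ⟨μ, hμA, hμcl⟩ := hmu
  obtain ⟨l, hlA, hlim⟩ := mem_closure_iff_seq_limit.1 hμcl
  choose z hz1 hz2 hz3 hz4 using fun n => exists_reflDiff_neg_critical hp hu he (hlA n)
  obtain ⟨x, -, φ, hφ, hzlim⟩ :=
    (isCompact_one_le hu.1.continuous hu.2.2).tendsto_subseq (x := z) hz2
  have hlim' : Tendsto (fun n => (l (φ n), z (φ n))) atTop (𝓝 (μ, x)) :=
    (hlim.comp hφ.tendsto_atTop).prodMk_nhds hzlim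
  have hfd : Continuous fun y => fderiv ℝ u y e :=
    (hu.1.continuous_fderiv (by norm_num)).clm_apply continuous_const
  have hx1 : μ ≤ inner ℝ e x :=
    le_of_tendsto_of_tendsto' (hlim.comp hφ.tendsto_atTop)
      (((by fun_prop : Continuous fun y : E3 => (inner ℝ e y : ℝ)).tendsto x).comp hzlim)
      fun n => hz1 (φ n)
  have hx3 : reflDiff u e μ x ≤ 0 := by
    have hc : Continuous fun q : ℝ × E3 => reflDiff u e q.1 q.2 :=
      (hu.1.continuous.comp (continuous_planeRefl_uncurry e)).sub
        (hu.1.continuous.comp continuous_snd)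
    exact le_of_tendsto' ((hc.tendsto _).comp hlim') fun n => hz3 (φ n)
  have hx4 : fderiv ℝ u (planeRefl e μ x) e + fderiv ℝ u x e = 0 := by
    have hc : Continuous fun q : ℝ × E3 =>
        fderiv ℝ u (planeRefl e q.1 q.2) e + fderiv ℝ u q.2 e :=
      (hfd.comp (continuous_planeRefl_uncurry e)).add (hfd.comp continuous_snd)
    exact tendsto_nhds_unique ((hc.tendsto _).comp hlim')
      (tendsto_const_nhds.congr fun n => (hz4 (φ n)).symm)
  have hcd := contDiff_reflDiff hu.1 e μ
  have hlapn : ∀ y, μ < inner ℝ e y → lap (reflDiff u e μ) y ≤ 0 := fun y hy =>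
    lap_reflDiff_nonpos hp hu he (Or.inl (hμA y hy.le))
  have hzero : ∀ c, μ < inner ℝ e c → reflDiff u e μ c ≤ 0 := by
    by_contra! hcon
    obtain ⟨c, hc, hvc⟩ := hcon
    have hvpos := pos_of_lap_nonpos_halfspace hcd he hlapn hμA hc hvc
    have hxμ : inner ℝ e x = μ := by
      refine le_antisymm (le_of_not_gt fun hgt => ?_) hx1
      exact absurd (hvpos x hgt) (not_lt.2 hx3)
    obtain ⟨ε, hε, hb⟩ := exists_linear_lower_bound hcd he hlapn hμA hvpos hxμ
    have hd := hasDerivAt_reflDiff_line hu.1 he μ x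
    rw [hx4, neg_zero] at hd
    have hslope := hd.tendsto_slope_zero_right
    have hev : ∀ᶠ t in 𝓝[>] (0 : ℝ), ε ≤ t⁻¹ • (reflDiff u e μ (x + (0 + t) • e) -
        reflDiff u e μ (x + (0 : ℝ) • e)) := by
      filter_upwards [Ioo_mem_nhdsGT (show (0 : ℝ) < 1 / 2 by norm_num)] with t ht
      rw [zero_smul, add_zero, reflDiff_of_mem u hxμ, zero_add, sub_zero, smul_eq_mul,
        ← div_eq_inv_mul, le_div_iff₀ ht.1]
      exact hb t ht.1 ht.2.le
    exact absurd (ge_of_tendsto hslope hev) (not_le.2 hε)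
  have hhalf : ∀ x, μ ≤ inner ℝ e x → u (planeRefl e μ x) = u x := by
    intro y hy
    rcases hy.eq_or_lt with h | h
    · rw [planeRefl_of_mem h.symm]
    · exact sub_eq_zero.1 (le_antisymm (hzero y h) (hμA y hy))
  refine ⟨μ, fun y => ?_⟩
  rcases le_total μ (inner ℝ e y) with h | h
  · exact hhalf y h
  · have := hhalf (planeRefl e μ y) (by rw [inner_planeRefl he]; linarith)
    rw [planeRefl_planeRefl he] at this
    exact this.symm

theorem planeRefl_normalize_sub {x y : E3} (h : ‖x‖ = ‖y‖) (hxy : x ≠ y) :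
    planeRefl (‖x - y‖⁻¹ • (x - y)) 0 x = y := by
  have h0 : ‖x - y‖ ≠ 0 := norm_ne_zero_iff.2 (sub_ne_zero.2 hxy)
  have h1 : 2 * inner ℝ (x - y) x = ‖x - y‖ ^ 2 := by
    rw [@norm_sub_sq_real, inner_sub_left, real_inner_self_eq_norm_sq, real_inner_comm, h]; ring
  have h2 : 2 * (inner ℝ (‖x - y‖⁻¹ • (x - y)) x - 0) * ‖x - y‖⁻¹ = 1 := by
    rw [real_inner_smul_left, sub_zero]
    calc 2 * (‖x - y‖⁻¹ * inner ℝ (x - y) x) * ‖x - y‖⁻¹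
        = (2 * inner ℝ (x - y) x) * (‖x - y‖⁻¹ * ‖x - y‖⁻¹) := by ring
      _ = 1 := by rw [h1]; field_simp
  rw [planeRefl, smul_smul, h2, one_smul, sub_sub_cancel]

theorem planeRefl_coordinates (a x : E3) :
    planeRefl (EuclideanSpace.single 0 1) (a 0) (planeRefl (EuclideanSpace.single 1 1) (a 1)
      (planeRefl (EuclideanSpace.single 2 1) (a 2) (x + a))) = -x + a := by
  ext i
  fin_cases i <;> simp [planeRefl, EuclideanSpace.inner_single_left] <;> ring

theorem tendsto_smul_cocompact {e : E3} (he : ‖e‖ = 1) {a : ℝ} (ha : a ≠ 0) :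
    Tendsto (fun n : ℕ => ((n : ℝ) * a) • e) atTop (cocompact E3) := by
  rw [← Metric.cobounded_eq_cocompact, ← tendsto_norm_atTop_iff_cobounded]
  simp only [norm_smul, he, norm_mul, Real.norm_natCast, mul_one]
  exact tendsto_natCast_atTop_atTop.atTop_mul_const (norm_pos_iff.2 ha)

/-- A positive solution is radially symmetric about some point. -/
theorem exists_radial_center {p : ℝ} (hp : 0 < p) {u : E3 → ℝ} (hu : IsCellSolution p u)
    (hpos : ∀ x, 0 < u x) : ∃ x₀ : E3, ∀ x y, ‖x‖ = ‖y‖ → u (x + x₀) = u (y + x₀) := by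
  choose l hl using fun (e : E3) (he : ‖e‖ = 1) => exists_symmetry_plane hp hu hpos he
  have hs : ∀ i : Fin 3, ‖(EuclideanSpace.single i 1 : E3)‖ = 1 := fun i => by simp
  set a : E3 := WithLp.toLp 2 fun i => l _ (hs i) with ha
  have heven : ∀ x, u (-x + a) = u (x + a) := fun x => by
    rw [← planeRefl_coordinates]
    exact (hl _ (hs 0) _).trans ((hl _ (hs 1) _).trans (hl _ (hs 2) _))
  have hshift : ∀ (e : E3) (d : ℝ) (x : E3),
      planeRefl e (inner ℝ e a + d) (x + a) = planeRefl e d x + a := fun e d x => by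
    simp only [planeRefl, inner_add_right]
    module
  have hcenter : ∀ (e : E3) (he : ‖e‖ = 1), l e he = inner ℝ e a := by
    intro e he
    by_contra hne
    set d := l e he - inner ℝ e a with hd
    have hd0 : d ≠ 0 := sub_ne_zero.2 hne
    have hrefl : ∀ x, u (planeRefl e d x + a) = u (x + a) := fun x => by
      rw [← hshift, hd, add_sub_cancel]
      exact hl e he _
    have hper : ∀ n : ℕ, u (((n : ℝ) * (2 * d)) • e + a) = u (0 + a) := by
      intro n
      induction n with
      | zero => simp
      | succ n ih =>
        rw [← ih, ← heven (((n : ℝ) * (2 * d)) • e), ← hrefl (-(((n : ℝ) * (2 * d)) • e))]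
        congr 2
        simp only [planeRefl, inner_neg_right, inner_smul_right, real_inner_self_eq_norm_sq, he]
        push_cast
        module
    have hlim : Tendsto (fun n : ℕ => u (((n : ℝ) * (2 * d)) • e + a)) atTop (𝓝 0) :=
      hu.2.2.comp ((Homeomorph.addRight a).isClosedEmbedding.tendsto_cocompact.comp
        (tendsto_smul_cocompact he (mul_ne_zero two_ne_zero hd0)))
    simp only [hper] at hlim
    exact (hpos (0 + a)).ne' (tendsto_nhds_unique tendsto_const_nhds hlim)
  refine ⟨a, fun x y hxy => ?_⟩
  rcases eq_or_ne x y with rfl | hne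
  · rfl
  have he : ‖‖x - y‖⁻¹ • (x - y)‖ = 1 := by
    rw [norm_smul, norm_inv, norm_norm, inv_mul_cancel₀ (norm_ne_zero_iff.2 (sub_ne_zero.2 hne))]
  have h1 := hl _ he (x + a)
  rw [hcenter, ← add_zero (inner ℝ _ a), hshift, planeRefl_normalize_sub hxy hne] at h1
  exact h1.symm

/-- The nonlinearity `s₊ ^ p`, truncated at `s = 1`. -/
noncomputable def truncPow (p s : ℝ) : ℝ := (max (min s 1) 0) ^ p

theorem truncPow_nonneg (p s : ℝ) : 0 ≤ truncPow p s := Real.rpow_nonneg (le_max_right _ _) _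

theorem truncPow_le_one {p : ℝ} (hp : 1 ≤ p) (s : ℝ) : truncPow p s ≤ 1 :=
  Real.rpow_le_one (le_max_right _ _) (max_le (min_le_right _ _) zero_le_one) (by linarith)

theorem truncPow_of_le_one (p : ℝ) {s : ℝ} (hs : s ≤ 1) : truncPow p s = (max s 0) ^ p := by
  rw [truncPow, min_eq_left hs]

theorem abs_rpow_sub_rpow_le {p : ℝ} (hp : 1 ≤ p) {a b : ℝ} (ha : a ∈ Icc (0 : ℝ) 1)
    (hb : b ∈ Icc (0 : ℝ) 1) : |a ^ p - b ^ p| ≤ p * |a - b| := by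
  have := (convex_Icc (0 : ℝ) 1).norm_image_sub_le_of_norm_hasDerivWithin_le
    (f := fun x : ℝ => x ^ p) (f' := fun x => p * x ^ (p - 1)) (C := p)
    (fun x _ => (Real.hasDerivAt_rpow_const (Or.inr hp)).hasDerivWithinAt)
    (fun x hx => by
      rw [Real.norm_eq_abs, abs_of_nonneg (mul_nonneg (by linarith) (Real.rpow_nonneg hx.1 _))]
      exact mul_le_of_le_one_right (by linarith) (Real.rpow_le_one hx.1 hx.2 (by linarith)))
    hb ha
  simpa [Real.norm_eq_abs] using this

theorem abs_truncPow_sub_le {p : ℝ} (hp : 1 ≤ p) (a b : ℝ) :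
    |truncPow p a - truncPow p b| ≤ p * |a - b| := by
  refine (abs_rpow_sub_rpow_le hp ⟨le_max_right _ _, max_le (min_le_right _ _) zero_le_one⟩
    ⟨le_max_right _ _, max_le (min_le_right _ _) zero_le_one⟩).trans ?_
  refine mul_le_mul_of_nonneg_left ?_ (by linarith)
  refine (abs_max_sub_max_le_abs _ _ _).trans ?_
  simpa using abs_min_sub_min_le_max a 1 b 1

theorem continuous_truncPow {p : ℝ} (hp : 1 ≤ p) : Continuous (truncPow p) := by
  unfold truncPow
  exact ((continuous_id.min continuous_const).max continuous_const).rpow_const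
    fun _ => Or.inr (by linarith)

/-- The planar vector field of the radial equation `(t v)'' = - t f(v)` for `G = t v`,
with the nonlinearity truncated. -/
noncomputable def radialField (p t : ℝ) (z : ℝ × ℝ) : ℝ × ℝ := (z.2, -(t * truncPow p (z.1 / t)))

theorem lipschitzWith_radialField {p : ℝ} (hp : 1 ≤ p) (t : ℝ) :
    LipschitzWith (Real.toNNReal p) (radialField p t) := by
  refine LipschitzWith.of_dist_le_mul fun z z' => ?_
  rw [Real.coe_toNNReal _ (by linarith)]
  have h1 : |z.1 - z'.1| ≤ dist z z' := by rw [← Real.dist_eq]; exact le_max_left _ _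
  have h2 : |z.2 - z'.2| ≤ dist z z' := by rw [← Real.dist_eq]; exact le_max_right _ _
  have h0 : 0 ≤ dist z z' := dist_nonneg
  refine max_le ?_ ?_
  · simp only [radialField, Real.dist_eq]
    nlinarith
  · simp only [radialField, Real.dist_eq]
    rcases eq_or_ne t 0 with rfl | ht
    · simp only [zero_mul, sub_self, abs_zero, neg_zero]
      positivity
    · calc |-(t * truncPow p (z.1 / t)) - -(t * truncPow p (z'.1 / t))|
          = |t| * |truncPow p (z.1 / t) - truncPow p (z'.1 / t)| := by
            rw [← abs_mul, ← abs_neg]; congr 1; ring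
        _ ≤ |t| * (p * |z.1 / t - z'.1 / t|) :=
            mul_le_mul_of_nonneg_left (abs_truncPow_sub_le hp _ _) (abs_nonneg _)
        _ = p * |z.1 - z'.1| := by
            rw [← sub_div, abs_div]; field_simp
        _ ≤ p * dist z z' := mul_le_mul_of_nonneg_left h1 (by linarith)

theorem continuous_mul_truncPow_div {p : ℝ} (hp : 1 ≤ p) (x : ℝ) :
    Continuous fun t => t * truncPow p (x / t) := by
  rw [continuous_iff_continuousAt]
  intro t
  rcases eq_or_ne t 0 with rfl | ht
  · rw [ContinuousAt, zero_mul]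
    refine squeeze_zero_norm (fun t => ?_) (show Tendsto (fun t : ℝ => |t|) (𝓝 0) (𝓝 0) by
      simpa using continuous_abs.tendsto (0 : ℝ))
    rw [norm_mul, Real.norm_eq_abs, Real.norm_eq_abs, abs_of_nonneg (truncPow_nonneg _ _)]
    exact mul_le_of_le_one_right (abs_nonneg _) (truncPow_le_one hp _)
  · exact continuousAt_id.mul ((continuous_truncPow hp).continuousAt.comp
      (continuousAt_const.div continuousAt_id ht))

theorem exists_radialField_solution_Ioo {p : ℝ} (hp : 1 ≤ p) {T : ℝ} (hT : 0 < T) :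
    ∃ α : ℝ → ℝ × ℝ, α 0 = (0, 1) ∧
      ∀ t ∈ Ioo (-T) T, HasDerivAt α (radialField p t (α t)) t := by
  set B : ℝ := 1 + T ^ 2 with hB
  have hBpos : 0 < B := by positivity
  set clamp : ℝ → ℝ := fun y => max (min y B) (-B) with hclamp
  have hclip : ∀ y y', |clamp y - clamp y'| ≤ |y - y'| := fun y y' => by
    refine (abs_max_sub_max_le_abs _ _ _).trans ?_
    simpa using abs_min_sub_min_le_max y B y' B
  have hcabs : ∀ y, |clamp y| ≤ B := fun y =>
    abs_le.2 ⟨le_max_right _ _, max_le (min_le_right _ _) (by linarith)⟩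
  set V : ℝ → ℝ × ℝ → ℝ × ℝ := fun t z => radialField p t (z.1, clamp z.2) with hV
  have hclipL : LipschitzWith 1 fun z : ℝ × ℝ => (z.1, clamp z.2) := by
    refine LipschitzWith.of_dist_le_mul fun z z' => ?_
    rw [NNReal.coe_one, one_mul]
    exact max_le (le_max_left _ _) ((hclip _ _).trans (le_max_right _ _))
  have hforce : ∀ t ∈ Icc (-T) T, ∀ x, |t * truncPow p (x / t)| ≤ T := fun t ht x => by
    rw [abs_mul, abs_of_nonneg (truncPow_nonneg _ _)]
    exact (mul_le_of_le_one_right (abs_nonneg _) (truncPow_le_one hp _)).trans (abs_le.2 ht)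
  have hTB : T ≤ B := by nlinarith [sq_nonneg (T - 1)]
  have hPL : IsPicardLindelof V (tmin := -T) (tmax := T) ⟨0, by constructor <;> linarith⟩
      ((0 : ℝ), (1 : ℝ)) (Real.toNNReal (B * T)) 0 (Real.toNNReal B) (Real.toNNReal p) := by
    refine ⟨fun t ht => ?_, fun x hx => ?_, fun t ht x hx => ?_, ?_⟩
    · have := ((lipschitzWith_radialField hp t).comp hclipL)
      rw [mul_one] at this
      exact this.lipschitzOnWith
    · exact (continuous_const.prodMk (continuous_mul_truncPow_div hp _).neg).continuousOn
    · rw [Real.coe_toNNReal _ hBpos.le]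
      refine max_le (hcabs _) ?_
      simp only [hV, radialField, norm_neg]
      exact (hforce t ht _).trans hTB
    · rw [Real.coe_toNNReal _ hBpos.le, Real.coe_toNNReal _ (by positivity)]
      simp
  obtain ⟨α, hα0, hα⟩ := hPL.exists_eq_forall_mem_Icc_hasDerivWithinAt₀
  replace hα0 : α 0 = (0, 1) := hα0
  refine ⟨α, hα0, fun t ht => ?_⟩
  have hsnd : ∀ s ∈ Icc (-T) T, HasDerivWithinAt (fun s => (α s).2)
      (-(s * truncPow p ((α s).1 / s))) (Icc (-T) T) s := fun s hs => (hα s hs).snd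
  have hb := (convex_Icc (-T) T).norm_image_sub_le_of_norm_hasDerivWithin_le hsnd (C := T)
    (fun s hs => by rw [norm_neg]; exact hforce s hs _)
    (⟨by linarith, by linarith⟩ : (0 : ℝ) ∈ Icc (-T) T) (Ioo_subset_Icc_self ht)
  have h1 : |(α t).2 - 1| ≤ T * T := by
    rw [hα0] at hb
    refine hb.trans (mul_le_mul_of_nonneg_left ?_ hT.le)
    rw [sub_zero]
    exact abs_le.2 ⟨ht.1.le, ht.2.le⟩
  have h2 : clamp (α t).2 = (α t).2 := by
    obtain ⟨h3, h4⟩ := abs_le.1 h1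
    simp only [hclamp]
    rw [min_eq_left (by nlinarith), max_eq_left (by nlinarith)]
  have := (hα t (Ioo_subset_Icc_self ht)).hasDerivAt (Icc_mem_nhds ht.1 ht.2)
  simpa only [hV, h2] using this

theorem exists_radialField_solution {p : ℝ} (hp : 1 ≤ p) :
    ∃ α : ℝ → ℝ × ℝ, α 0 = (0, 1) ∧ ∀ t, HasDerivAt α (radialField p t (α t)) t := by
  choose A hA0 hA using fun n : ℕ =>
    exists_radialField_solution_Ioo hp (T := (n : ℝ) + 1) (by positivity)
  have huniq : ∀ m n : ℕ, m ≤ n → ∀ t ∈ Ioo (-((m : ℝ) + 1)) ((m : ℝ) + 1), A n t = A m t := by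
    intro m n hmn t ht
    have hmn' : (m : ℝ) ≤ n := by exact_mod_cast hmn
    exact ODE_solution_unique_of_mem_Ioo (s := fun _ => univ) (t₀ := 0)
      (fun s _ => (lipschitzWith_radialField hp s).lipschitzOnWith)
      ⟨by linarith [m.cast_nonneg (α := ℝ)], by positivity⟩
      (fun s hs => ⟨hA n s ⟨by linarith [hs.1], by linarith [hs.2]⟩, mem_univ _⟩)
      (fun s hs => ⟨hA m s hs, mem_univ _⟩) (by rw [hA0, hA0]) ht
  have hmem : ∀ t : ℝ, t ∈ Ioo (-((⌈|t|⌉₊ : ℝ) + 1)) ((⌈|t|⌉₊ : ℝ) + 1) := fun t => by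
    have := Nat.le_ceil |t|
    rw [mem_Ioo, ← abs_lt]
    linarith
  refine ⟨fun t => A ⌈|t|⌉₊ t, by simp [hA0], fun t => ?_⟩
  refine (hA _ t (hmem t)).congr_of_eventuallyEq ?_
  filter_upwards [Ioo_mem_nhds (hmem t).1 (hmem t).2] with s hs
  rcases le_total ⌈|s|⌉₊ ⌈|t|⌉₊ with h | h
  · exact (huniq _ _ h s (hmem s)).symm
  · exact huniq _ _ h s hs

/-- `G` solves `G'' = - t f(G / t)` with `G 0 = 0`, `G' 0 = 1` (and `H = G'`), where `f` is the
truncated nonlinearity. -/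
structure IsProfile (p : ℝ) (G H : ℝ → ℝ) : Prop where
  hasDerivAt_fst : ∀ t, HasDerivAt G (H t) t
  hasDerivAt_snd : ∀ t, HasDerivAt H (-(t * truncPow p (G t / t))) t
  fst_zero : G 0 = 0
  snd_zero : H 0 = 1

theorem exists_isProfile {p : ℝ} (hp : 1 ≤ p) : ∃ G H, IsProfile p G H := by
  obtain ⟨α, h0, h⟩ := exists_radialField_solution hp
  exact ⟨fun t => (α t).1, fun t => (α t).2, fun t => (h t).fst, fun t => (h t).snd,
    by rw [h0], by rw [h0]⟩

theorem truncPow_mono {p : ℝ} (hp : 0 ≤ p) : Monotone (truncPow p) := fun _ _ h =>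
  Real.rpow_le_rpow (le_max_right _ _) (max_le_max (min_le_min h le_rfl) le_rfl) hp

theorem truncPow_pos (p : ℝ) {s : ℝ} (hs : 0 < s) : 0 < truncPow p s :=
  Real.rpow_pos_of_pos (lt_max_of_lt_left (lt_min hs zero_lt_one)) _

theorem truncPow_of_nonpos {p : ℝ} (hp : p ≠ 0) {s : ℝ} (hs : s ≤ 0) : truncPow p s = 0 := by
  rw [truncPow_of_le_one p (hs.trans zero_le_one), max_eq_right hs, Real.zero_rpow hp]

theorem truncPow_of_mem (p : ℝ) {s : ℝ} (h0 : 0 ≤ s) (h1 : s ≤ 1) : truncPow p s = s ^ p := by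
  rw [truncPow_of_le_one p h1, max_eq_left h0]

namespace IsProfile

variable {p : ℝ} {G H : ℝ → ℝ}

theorem hasDerivAt_mul_sub (h : IsProfile p G H) (t : ℝ) :
    HasDerivAt (fun t => t * H t - G t) (-(t ^ 2 * truncPow p (G t / t))) t :=
  (((hasDerivAt_id t).mul (h.hasDerivAt_snd t)).sub (h.hasDerivAt_fst t)).congr_deriv
    (by simp only [id]; ring)

theorem hasDerivAt_div (h : IsProfile p G H) {t : ℝ} (ht : t ≠ 0) :
    HasDerivAt (fun t => G t / t) ((t * H t - G t) / t ^ 2) t :=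
  ((h.hasDerivAt_fst t).div (hasDerivAt_id t) ht).congr_deriv (by simp only [id]; ring)

theorem antitone_mul_sub (h : IsProfile p G H) : Antitone fun t => t * H t - G t :=
  antitone_of_deriv_nonpos (fun t => (h.hasDerivAt_mul_sub t).differentiableAt) fun t => by
    rw [(h.hasDerivAt_mul_sub t).deriv]
    have := truncPow_nonneg p (G t / t)
    nlinarith [sq_nonneg t]

theorem mul_sub_nonpos (h : IsProfile p G H) {t : ℝ} (ht : 0 ≤ t) : t * H t - G t ≤ 0 := by
  have := h.antitone_mul_sub ht
  simpa [h.fst_zero] using this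

theorem antitoneOn_div (h : IsProfile p G H) : AntitoneOn (fun t => G t / t) (Ioi 0) :=
  antitoneOn_of_deriv_nonpos (convex_Ioi 0)
    (fun t ht => (h.hasDerivAt_div (ne_of_gt ht)).continuousAt.continuousWithinAt)
    (fun t ht => by
      rw [interior_Ioi] at ht
      exact (h.hasDerivAt_div (ne_of_gt ht)).differentiableAt.differentiableWithinAt)
    (fun t ht => by
      rw [interior_Ioi] at ht
      rw [(h.hasDerivAt_div (ne_of_gt ht)).deriv]
      exact div_nonpos_of_nonpos_of_nonneg (h.mul_sub_nonpos (le_of_lt ht)) (sq_nonneg t))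

theorem tendsto_div_zero (h : IsProfile p G H) :
    Tendsto (fun t => G t / t) (𝓝[>] 0) (𝓝 1) := by
  have := (h.hasDerivAt_fst 0).tendsto_slope_zero_right
  simpa [h.fst_zero, h.snd_zero, div_eq_inv_mul] using this

theorem div_le_one (h : IsProfile p G H) {t : ℝ} (ht : 0 < t) : G t / t ≤ 1 := by
  refine ge_of_tendsto h.tendsto_div_zero ?_
  filter_upwards [Ioo_mem_nhdsGT ht] with s hs
  exact h.antitoneOn_div hs.1 ht hs.2.le

theorem mul_sub_le (h : IsProfile p G H) (hp : 0 ≤ p) {T : ℝ} (hT : 0 < T) :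
    T * H T - G T ≤ -(T ^ 3 * truncPow p (G T / T) / 3) := by
  have hd : ∀ t, HasDerivAt (fun t => t * H t - G t + t ^ 3 * (truncPow p (G T / T) / 3))
      (-(t ^ 2 * truncPow p (G t / t)) + t ^ 2 * truncPow p (G T / T)) t := fun t =>
    ((h.hasDerivAt_mul_sub t).add ((hasDerivAt_pow 3 t).mul_const _)).congr_deriv
      (by push_cast; ring)
  have hanti : AntitoneOn (fun t => t * H t - G t + t ^ 3 * (truncPow p (G T / T) / 3))
      (Icc 0 T) := by
    refine antitoneOn_of_deriv_nonpos (convex_Icc 0 T)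
      (fun t _ => (hd t).continuousAt.continuousWithinAt)
      (fun t _ => (hd t).differentiableAt.differentiableWithinAt) fun t ht => ?_
    rw [interior_Icc] at ht
    rw [(hd t).deriv]
    have := truncPow_mono hp (h.antitoneOn_div ht.1 hT ht.2.le)
    have h2 : 0 ≤ t ^ 2 := sq_nonneg t
    nlinarith
  have := hanti (left_mem_Icc.2 hT.le) (right_mem_Icc.2 hT.le) hT.le
  simp only [h.fst_zero] at this
  norm_num at this
  linarith

theorem mul_sub_neg (h : IsProfile p G H) (hp : 0 ≤ p) {T : ℝ} (hT : 0 < T) :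
    T * H T - G T < 0 := by
  obtain ⟨t, ht1, ht2⟩ := ((h.tendsto_div_zero.eventually (eventually_gt_nhds zero_lt_one)).and
    (Ioo_mem_nhdsGT hT)).exists
  have h1 := h.mul_sub_le hp ht2.1
  have h2 := h.antitone_mul_sub ht2.2.le
  have h3 := truncPow_pos p ht1
  have h4 : 0 < t ^ 3 := pow_pos ht2.1 3
  have h5 : 0 < t ^ 3 * truncPow p (G t / t) / 3 := by positivity
  simp only at h2
  linarith

theorem strictAntiOn_div (h : IsProfile p G H) (hp : 0 ≤ p) :
    StrictAntiOn (fun t => G t / t) (Ioi 0) :=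
  strictAntiOn_of_deriv_neg (convex_Ioi 0)
    (fun t ht => (h.hasDerivAt_div (ne_of_gt ht)).continuousAt.continuousWithinAt)
    (fun t ht => by
      rw [interior_Ioi] at ht
      rw [(h.hasDerivAt_div (ne_of_gt ht)).deriv]
      exact div_neg_of_neg_of_pos (h.mul_sub_neg hp ht) (pow_pos ht 2))

theorem le_decay (h : IsProfile p G H) (hp : 1 < p) (hpos : ∀ t, 0 < t → 0 < G t / t) {t : ℝ}
    (ht : 2 ≤ t) : G t / t ≤ ((p - 1) / 8) ^ (-1 / (p - 1)) * t ^ (-(2 / (p - 1))) := by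
  have hp1 : 0 < p - 1 := by linarith
  have hd : ∀ t, 0 < t → HasDerivAt (fun t => (G t / t) ^ (1 - p) - (p - 1) / 6 * t ^ 2)
      ((t * H t - G t) / t ^ 2 * (1 - p) * (G t / t) ^ (1 - p - 1) - (p - 1) / 6 * (2 * t)) t :=
    fun t ht => ((h.hasDerivAt_div ht.ne').rpow_const (Or.inl (hpos t ht).ne')).sub
      (((hasDerivAt_pow 2 t).const_mul _).congr_deriv (by push_cast; ring))
  have hmono : MonotoneOn (fun t => (G t / t) ^ (1 - p) - (p - 1) / 6 * t ^ 2) (Ioi 0) := by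
    refine monotoneOn_of_deriv_nonneg (convex_Ioi 0)
      (fun t ht => (hd t ht).continuousAt.continuousWithinAt)
      (fun t ht => (hd t (interior_subset ht)).differentiableAt.differentiableWithinAt)
      fun t ht => ?_
    rw [interior_Ioi] at ht
    replace ht : 0 < t := ht
    rw [(hd t ht).deriv]
    have hv := hpos t ht
    have h1 := h.mul_sub_le (by linarith) ht
    rw [truncPow_of_mem p hv.le (h.div_le_one ht)] at h1
    set v := G t / t with hvdef
    have h2 : v ^ p * v ^ (1 - p - 1) = 1 := by
      rw [← Real.rpow_add hv]; norm_num
    have h3 : 0 < v ^ (1 - p - 1) := Real.rpow_pos_of_pos hv _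
    have h4 : (p - 1) / 3 * t ≤ (t * H t - G t) / t ^ 2 * (1 - p) * v ^ (1 - p - 1) := by
      have h5 : t ^ 3 / 3 ≤ -(t * H t - G t) * v ^ (1 - p - 1) := by
        calc t ^ 3 / 3 = (t ^ 3 * v ^ p / 3) * v ^ (1 - p - 1) := by
              rw [show t ^ 3 * v ^ p / 3 * v ^ (1 - p - 1) =
                t ^ 3 / 3 * (v ^ p * v ^ (1 - p - 1)) by ring, h2, mul_one]
          _ ≤ _ := mul_le_mul_of_nonneg_right (by linarith) h3.le
      calc (p - 1) / 3 * t = (p - 1) / t ^ 2 * (t ^ 3 / 3) := by field_simp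
        _ ≤ (p - 1) / t ^ 2 * (-(t * H t - G t) * v ^ (1 - p - 1)) :=
            mul_le_mul_of_nonneg_left h5 (by positivity)
        _ = _ := by ring
    linarith
  have ht0 : 0 < t := by linarith
  have h1 := hmono (mem_Ioi.2 one_pos) ht0 (by linarith)
  simp only at h1
  have h2 : 0 ≤ (G 1 / 1) ^ (1 - p) := Real.rpow_nonneg (hpos 1 one_pos).le _
  have h3 : (p - 1) / 8 * t ^ 2 ≤ (G t / t) ^ (1 - p) := by
    have : 0 ≤ (p - 1) * (t ^ 2 - 4) := mul_nonneg hp1.le (by nlinarith)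
    linarith
  have h4 := Real.rpow_le_rpow_of_nonpos (by positivity) h3
    (show -1 / (p - 1) ≤ 0 from div_nonpos_of_nonpos_of_nonneg (by norm_num) hp1.le)
  rw [← Real.rpow_mul (hpos t ht0).le, show (1 - p) * (-1 / (p - 1)) = 1 by field_simp; ring,
    Real.rpow_one, Real.mul_rpow (by positivity) (by positivity), ← Real.rpow_natCast t 2,
    ← Real.rpow_mul ht0.le] at h4
  refine h4.trans (le_of_eq ?_)
  congr 2
  push_cast
  ring

/-- The Pohozaev functional. -/
noncomputable def pohozaev (p : ℝ) (G H : ℝ → ℝ) (t : ℝ) : ℝ :=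
  (t * H t - G t) * H t / 2 + t ^ 3 * (G t / t) ^ (p + 1) / (p + 1)

theorem hasDerivAt_pohozaev (h : IsProfile p G H) (hp : 1 < p) {t : ℝ} (ht : 0 < t)
    (hv : 0 < G t / t) : HasDerivAt (pohozaev p G H)
      ((3 / (p + 1) - 1 / 2) * (t ^ 2 * (G t / t) ^ (p + 1))) t := by
  have hp1 : p + 1 ≠ 0 := by linarith
  have h1 := (((h.hasDerivAt_mul_sub t).mul (h.hasDerivAt_snd t)).div_const 2).add
    (((hasDerivAt_pow 3 t).mul ((h.hasDerivAt_div ht.ne').rpow_const (p := p + 1)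
      (Or.inl hv.ne'))).div_const (p + 1))
  refine h1.congr_deriv ?_
  rw [truncPow_of_mem p hv.le (h.div_le_one ht), add_sub_cancel_right, Real.rpow_add hv,
    Real.rpow_one]
  have hG : G t = G t / t * t := by field_simp
  generalize G t / t = v at *
  generalize v ^ p = w
  rw [hG]
  push_cast
  field_simp
  ring

theorem exists_pohozaev_lower_bound (h : IsProfile p G H) (hp : 1 < p) (hp5 : p < 5)
    (hpos : ∀ t, 0 < t → 0 < G t / t) : ∃ c > 0, ∀ t, 1 ≤ t → c ≤ pohozaev p G H t := by
  have hcoef : 0 < 3 / (p + 1) - 1 / 2 := by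
    rw [sub_pos, div_lt_div_iff₀ (by norm_num) (by linarith)]; linarith
  have hmono : StrictMonoOn (pohozaev p G H) (Ioi 0) := by
    refine strictMonoOn_of_deriv_pos (convex_Ioi 0)
      (fun t ht => (h.hasDerivAt_pohozaev hp ht (hpos t ht)).continuousAt.continuousWithinAt)
      fun t ht => ?_
    rw [interior_Ioi] at ht
    rw [(h.hasDerivAt_pohozaev hp ht (hpos t ht)).deriv]
    exact mul_pos hcoef (mul_pos (pow_pos ht 2) (Real.rpow_pos_of_pos (hpos t ht) _))
  have hlim : Tendsto (pohozaev p G H) (𝓝[>] 0) (𝓝 0) := by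
    have hH : Tendsto H (𝓝[>] 0) (𝓝 1) := by
      have := (h.hasDerivAt_snd 0).continuousAt.tendsto.mono_left
        (nhdsWithin_le_nhds (s := Ioi 0))
      rwa [h.snd_zero] at this
    have hq : Tendsto (fun t => t * H t - G t) (𝓝[>] 0) (𝓝 0) := by
      have := (h.hasDerivAt_mul_sub 0).continuousAt.tendsto.mono_left
        (nhdsWithin_le_nhds (s := Ioi 0))
      simpa [h.fst_zero] using this
    have ht : Tendsto (fun t : ℝ => t ^ 3) (𝓝[>] 0) (𝓝 0) := by
      have := ((continuous_pow 3).tendsto (0 : ℝ)).mono_left (nhdsWithin_le_nhds (s := Ioi 0))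
      simpa using this
    have := ((hq.mul hH).div_const 2).add
      ((ht.mul (h.tendsto_div_zero.rpow_const (p := p + 1) (Or.inl one_ne_zero))).div_const (p + 1))
    simp only [mul_one, zero_mul, zero_div, add_zero] at this
    exact this
  have h1 : 0 ≤ pohozaev p G H (1 / 2) := by
    refine le_of_tendsto hlim ?_
    filter_upwards [Ioo_mem_nhdsGT (show (0 : ℝ) < 1 / 2 by norm_num)] with s hs
    exact hmono.monotoneOn hs.1 (show (0 : ℝ) < 1 / 2 by norm_num) hs.2.le
  refine ⟨pohozaev p G H 1, h1.trans_lt (hmono (show (0 : ℝ) < 1 / 2 by norm_num)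
    (show (0 : ℝ) < 1 by norm_num) (by norm_num)), fun t ht => ?_⟩
  exact hmono.monotoneOn (show (0 : ℝ) < 1 by norm_num) (show (0 : ℝ) < t by linarith) ht

/-- In the subcritical range the profile becomes negative. -/
theorem exists_neg (h : IsProfile p G H) (hp : 1 < p) (hp5 : p < 5) :
    ∃ t, 0 < t ∧ G t / t < 0 := by
  by_contra! hnn
  have hpos : ∀ t, 0 < t → 0 < G t / t := fun t ht =>
    (hnn (t + 1) (by linarith)).trans_lt (h.strictAntiOn_div (by linarith) ht
      (show (0 : ℝ) < t + 1 by linarith) (by linarith))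
  have hp1 : 0 < p - 1 := by linarith
  obtain ⟨c, hc, hP⟩ := h.exists_pohozaev_lower_bound hp hp5 hpos
  set C := ((p - 1) / 8) ^ (-1 / (p - 1)) with hC
  have hCpos : 0 < C := Real.rpow_pos_of_pos (by positivity) _
  set β := 2 / (p - 1) with hβ
  have hβ2 : 1 / 2 < β := by rw [hβ, div_lt_div_iff₀ (by norm_num) hp1]; linarith
  have hβ3 : 3 < β * (p + 1) := by
    rw [hβ, div_mul_eq_mul_div, lt_div_iff₀ hp1]; linarith
  have hdec : ∀ t, 2 ≤ t → G t / t ≤ C * t ^ (-β) := fun t ht => h.le_decay hp hpos ht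
  have hsmall : Tendsto (fun t : ℝ => t ^ 3 * (G t / t) ^ (p + 1) / (p + 1)) atTop (𝓝 0) := by
    have hb : Tendsto (fun t : ℝ => C ^ (p + 1) / (p + 1) * t ^ (-(β * (p + 1) - 3))) atTop
        (𝓝 0) := by
      simpa using (tendsto_rpow_neg_atTop (show 0 < β * (p + 1) - 3 by linarith)).const_mul
        (C ^ (p + 1) / (p + 1))
    refine squeeze_zero' ?_ ?_ hb
    · filter_upwards [eventually_gt_atTop 0] with t ht
      have := Real.rpow_nonneg (hpos t ht).le (p + 1)
      positivity
    · filter_upwards [eventually_ge_atTop 2] with t ht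
      have ht0 : 0 < t := by linarith
      have h1 := Real.rpow_le_rpow (hpos t ht0).le (hdec t ht) (show 0 ≤ p + 1 by linarith)
      rw [Real.mul_rpow hCpos.le (by positivity), ← Real.rpow_mul ht0.le] at h1
      calc t ^ 3 * (G t / t) ^ (p + 1) / (p + 1)
          ≤ t ^ 3 * (C ^ (p + 1) * t ^ (-β * (p + 1))) / (p + 1) := by gcongr
        _ = C ^ (p + 1) / (p + 1) * (t ^ (3 : ℝ) * t ^ (-β * (p + 1))) := by
            rw [← Real.rpow_natCast t 3]; push_cast; ring
        _ = _ := by rw [← Real.rpow_add ht0]; congr 2; ring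
  have hq : ∀ᶠ t in atTop, (t * H t - G t) / t ^ 2 ≤ -(√c * t ^ (-(3 / 2) : ℝ)) := by
    filter_upwards [hsmall.eventually (eventually_lt_nhds (half_pos hc)),
      eventually_ge_atTop 2] with t ht1 ht2
    have ht0 : 0 < t := by linarith
    have h1 := hP t (by linarith)
    have hqn := h.mul_sub_neg (by linarith) ht0
    rw [pohozaev] at h1
    have h2 : (t * H t - G t) * H t =
        (t * H t - G t) ^ 2 / t + (t * H t - G t) * (G t / t) := by field_simp; ring
    have h3 : (t * H t - G t) * (G t / t) ≤ 0 :=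
      mul_nonpos_of_nonpos_of_nonneg hqn.le (hpos t ht0).le
    have h4 : c * t ≤ (t * H t - G t) ^ 2 := by
      rw [← le_div_iff₀ ht0]; linarith
    have h5 : √c * √t ≤ -(t * H t - G t) := by
      rw [← Real.sqrt_mul hc.le]
      exact Real.sqrt_le_iff.2 ⟨by linarith, by rw [neg_sq]; exact h4⟩
    have h6 : t ^ (-(3 / 2) : ℝ) = √t / t ^ 2 := by
      rw [Real.sqrt_eq_rpow, ← Real.rpow_natCast t 2, ← Real.rpow_sub ht0]
      norm_num
    rw [h6, ← mul_div_assoc, ← neg_div]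
    gcongr
    linarith
  obtain ⟨R, hR⟩ := eventually_atTop.1 (hq.and (eventually_ge_atTop 2))
  have hd : ∀ t, 0 < t → HasDerivAt (fun t : ℝ => G t / t - 2 * √c * t ^ (-(1 / 2) : ℝ))
      ((t * H t - G t) / t ^ 2 + √c * t ^ (-(3 / 2) : ℝ)) t := fun t ht =>
    ((h.hasDerivAt_div ht.ne').sub ((Real.hasDerivAt_rpow_const (Or.inl ht.ne')).const_mul
      (2 * √c))).congr_deriv (by norm_num; ring)
  have hanti : AntitoneOn (fun t : ℝ => G t / t - 2 * √c * t ^ (-(1 / 2) : ℝ)) (Ici R) := by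
    have hR0 : ∀ t ∈ Ici R, 0 < t := fun t ht => by linarith [(hR t ht).2]
    refine antitoneOn_of_deriv_nonpos (convex_Ici R)
      (fun t ht => (hd t (hR0 t ht)).continuousAt.continuousWithinAt)
      (fun t ht => (hd t (hR0 t (interior_subset ht))).differentiableAt.differentiableWithinAt)
      fun t ht => ?_
    rw [(hd t (hR0 t (interior_subset ht))).deriv]
    linarith [(hR t (interior_subset ht)).1]
  have hhalf : Tendsto (fun t : ℝ => t ^ (-(1 / 2) : ℝ)) atTop (𝓝 0) :=
    tendsto_rpow_neg_atTop (by norm_num)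
  have hv0 : Tendsto (fun t => G t / t) atTop (𝓝 0) := by
    have hb : Tendsto (fun t : ℝ => C * t ^ (-β)) atTop (𝓝 0) := by
      simpa using (tendsto_rpow_neg_atTop (show 0 < β by linarith)).const_mul C
    refine squeeze_zero' ?_ ?_ hb
    · filter_upwards [eventually_gt_atTop 0] with t ht using (hpos t ht).le
    · filter_upwards [eventually_ge_atTop 2] with t ht using hdec t ht
  have hge : ∀ t ∈ Ici R, 2 * √c * t ^ (-(1 / 2) : ℝ) ≤ G t / t := fun t ht => by
    have hl : Tendsto (fun t : ℝ => G t / t - 2 * √c * t ^ (-(1 / 2) : ℝ)) atTop (𝓝 0) := by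
      simpa using hv0.sub (hhalf.const_mul (2 * √c))
    refine sub_nonneg.1 (le_of_tendsto hl ?_)
    filter_upwards [eventually_ge_atTop t] with s hs
    exact hanti ht (le_trans (show R ≤ t from ht) hs) hs
  have hfin : ∀ᶠ t : ℝ in atTop, 2 * √c ≤ C * t ^ (-(β - 1 / 2)) := by
    filter_upwards [eventually_ge_atTop R] with t ht
    have ht2 := (hR t ht).2
    have ht0 : 0 < t := by linarith
    have h1 := (hge t ht).trans (hdec t ht2)
    calc 2 * √c = 2 * √c * t ^ (-(1 / 2) : ℝ) * t ^ (1 / 2 : ℝ) := by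
          rw [mul_assoc, ← Real.rpow_add ht0]; norm_num
      _ ≤ C * t ^ (-β) * t ^ (1 / 2 : ℝ) := by gcongr
      _ = _ := by rw [mul_assoc, ← Real.rpow_add ht0]; congr 2; ring
  have hlim0 : Tendsto (fun t : ℝ => C * t ^ (-(β - 1 / 2))) atTop (𝓝 0) := by
    simpa using (tendsto_rpow_neg_atTop (show 0 < β - 1 / 2 by linarith)).const_mul C
  have := ge_of_tendsto hlim0 hfin
  have := Real.sqrt_pos.2 hc
  linarith

theorem exists_limit (h : IsProfile p G H) (hp : 1 < p) (hp5 : p < 5) :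
    ∃ L < 0, Tendsto (fun t => G t / t) atTop (𝓝 L) ∧ ∀ t, 0 < t → L < G t / t := by
  obtain ⟨T, hT, hneg⟩ := h.exists_neg hp hp5
  have hF : ∀ t ∈ Ici T, truncPow p (G t / t) = 0 := fun t ht =>
    truncPow_of_nonpos (by linarith) ((h.antitoneOn_div hT (hT.trans_le ht) ht).trans hneg.le)
  have hconst : ∀ t ∈ Ici T, H t = H T := fun t ht =>
    constant_of_has_deriv_right_zero (a := T) (b := t)
      (fun s _ => (h.hasDerivAt_snd s).continuousAt.continuousWithinAt)
      (fun s hs => by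
        have := (h.hasDerivAt_snd s).hasDerivWithinAt (s := Ici s)
        rwa [hF s hs.1, mul_zero, neg_zero] at this) t (right_mem_Icc.2 ht)
  have hconst' : ∀ t ∈ Ici T, t * H t - G t = T * H T - G T := fun t ht =>
    constant_of_has_deriv_right_zero (f := fun t => t * H t - G t) (a := T) (b := t)
      (fun s _ => (h.hasDerivAt_mul_sub s).continuousAt.continuousWithinAt)
      (fun s hs => by
        have := (h.hasDerivAt_mul_sub s).hasDerivWithinAt (s := Ici s)
        rwa [hF s hs.1, mul_zero, neg_zero] at this) t (right_mem_Icc.2 ht)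
  have hq := h.mul_sub_neg (by linarith) hT
  have hlim : Tendsto (fun t => G t / t) atTop (𝓝 (H T)) := by
    have h1 : Tendsto (fun t : ℝ => H T - (T * H T - G T) / t) atTop (𝓝 (H T)) := by
      simpa using (tendsto_const_nhds (x := H T)).sub
        (tendsto_const_nhds (x := T * H T - G T) |>.div_atTop tendsto_id)
    refine h1.congr' ?_
    filter_upwards [eventually_ge_atTop T] with t ht
    have ht0 : 0 < t := hT.trans_le ht
    rw [← hconst' t ht, hconst t ht]
    field_simp
    ring
  refine ⟨H T, ?_, hlim, fun t ht => ?_⟩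
  · have h1 : H T = G T / T + (T * H T - G T) / T := by field_simp; ring
    have h2 := div_neg_of_neg_of_pos hq hT
    linarith
  · have h1 : G (t + 1) / (t + 1) < G t / t := h.strictAntiOn_div (by linarith) ht
      (show (0 : ℝ) < t + 1 by linarith) (by linarith)
    refine lt_of_le_of_lt (le_of_tendsto hlim ?_) h1
    filter_upwards [eventually_ge_atTop (t + 1)] with s hs
    exact h.antitoneOn_div (show (0 : ℝ) < t + 1 by linarith) (show (0 : ℝ) < s by linarith) hs

end IsProfile

theorem tendsto_norm_nhdsGE : Tendsto (fun x : E3 => ‖x‖) (𝓝 0) (𝓝[≥] 0) :=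
  tendsto_nhdsWithin_iff.2 ⟨by simpa using continuous_norm.tendsto (0 : E3),
    Eventually.of_forall norm_nonneg⟩

set_option synthInstance.maxHeartbeats 200000 in
/-- A criterion for a radial function to be of class `C²`, with the formula for its Laplacian. -/
theorem contDiff_radial {φ ψ c : ℝ → ℝ} (h1 : ∀ t, 0 < t → HasDerivAt φ (t * ψ t) t)
    (h2 : ∀ t, 0 < t → HasDerivAt ψ (t * c t) t)
    (hO : (fun x : E3 => φ ‖x‖ - φ 0) =O[𝓝 0] fun x => ‖x - 0‖ ^ 2)
    (hψ : ContinuousWithinAt ψ (Ici 0) 0)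
    (hc : ContinuousOn c (Ioi 0)) (hc0 : Tendsto (fun t => t ^ 2 * c t) (𝓝[≥] 0) (𝓝 0)) :
    ContDiff ℝ 2 (fun x : E3 => φ ‖x‖) ∧
      ∀ x : E3, lap (fun x : E3 => φ ‖x‖) x = 3 * ψ ‖x‖ + ‖x‖ ^ 2 * c ‖x‖ := by
  have hd1 : ∀ x : E3, HasFDerivAt (fun x : E3 => φ ‖x‖) (ψ ‖x‖ • innerCLM x) x := by
    intro x
    rcases eq_or_ne x 0 with rfl | hx
    · have := (hO.hasFDerivAt (𝕜 := ℝ) one_lt_two).add_const (φ 0)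
      simpa using this
    · exact hasFDerivAt_radial hx (h1 _ (norm_pos_iff.2 hx))
  have hψ0 : Tendsto (fun x : E3 => ψ ‖x‖) (𝓝 0) (𝓝 (ψ 0)) := hψ.tendsto.comp tendsto_norm_nhdsGE
  have hd2 : ∀ x : E3, HasFDerivAt (fun y : E3 => ψ ‖y‖ • innerCLM y)
      (ψ ‖x‖ • innerCLM + (c ‖x‖ • innerCLM x).smulRight (innerCLM x)) x := by
    intro x
    rcases eq_or_ne x 0 with rfl | hx
    · rw [hasFDerivAt_iff_isLittleO]
      have hl : (fun x : E3 => ψ ‖x‖ - ψ 0) =o[𝓝 0] fun _ => (1 : ℝ) :=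
        (Asymptotics.isLittleO_one_iff ℝ).2 (by simpa using hψ0.sub_const (ψ 0))
      have hb : (fun x : E3 => innerCLM x) =O[𝓝 0] fun x => x :=
        innerCLM.isBigO_id _
      refine (hl.smul_isBigO hb).congr' (Eventually.of_forall fun y => ?_)
        (Eventually.of_forall fun y => ?_)
      · simp [sub_smul]
      · simp
    · exact hasFDerivAt_smul_innerSL hx (h2 _ (norm_pos_iff.2 hx))
  have hf1 : fderiv ℝ (fun x : E3 => φ ‖x‖) = fun x => ψ ‖x‖ • innerCLM x :=
    funext fun x => (hd1 x).fderiv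
  have hf2 : fderiv ℝ (fun x : E3 => ψ ‖x‖ • innerCLM x) =
      fun x => ψ ‖x‖ • innerCLM + (c ‖x‖ • innerCLM x).smulRight (innerCLM x) :=
    funext fun x => (hd2 x).fderiv
  refine ⟨?_, fun x => ?_⟩
  · rw [show (2 : WithTop ℕ∞) = 1 + 1 by norm_num, contDiff_succ_iff_fderiv, hf1,
      contDiff_one_iff_fderiv, hf2]
    refine ⟨fun x => (hd1 x).differentiableAt, by simp, fun x => (hd2 x).differentiableAt, ?_⟩
    refine continuous_clm_apply.2 fun y => continuous_clm_apply.2 fun z => ?_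
    have hM : (fun x : E3 => (ψ ‖x‖ • innerCLM + (c ‖x‖ • innerCLM x).smulRight (innerCLM x)) y z) =
        fun x : E3 => ψ ‖x‖ * inner ℝ y z + c ‖x‖ * (inner ℝ x y * inner ℝ x z) := by
      funext x
      simp [mul_assoc]
    rw [hM, continuous_iff_continuousAt]
    intro x
    rcases eq_or_ne x 0 with rfl | hx
    · have hz : Tendsto (fun x : E3 => c ‖x‖ * (inner ℝ x y * inner ℝ x z)) (𝓝 0) (𝓝 0) := by
        refine squeeze_zero_norm (fun x => ?_)
          (show Tendsto (fun x : E3 => |‖x‖ ^ 2 * c ‖x‖| * (‖y‖ * ‖z‖)) (𝓝 0) (𝓝 0) by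
            simpa using (hc0.comp tendsto_norm_nhdsGE).abs.mul_const (‖y‖ * ‖z‖))
        rw [norm_mul, norm_mul, abs_mul, abs_of_nonneg (sq_nonneg ‖x‖), Real.norm_eq_abs (c ‖x‖)]
        calc |c ‖x‖| * (‖inner ℝ x y‖ * ‖inner ℝ x z‖)
            ≤ |c ‖x‖| * ((‖x‖ * ‖y‖) * (‖x‖ * ‖z‖)) := by
              gcongr <;> exact norm_inner_le_norm _ _
          _ = ‖x‖ ^ 2 * |c ‖x‖| * (‖y‖ * ‖z‖) := by ring
      have := (hψ0.mul_const (inner ℝ y z)).add hz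
      rw [ContinuousAt]
      convert this using 2
      simp
    · have hx' : 0 < ‖x‖ := norm_pos_iff.2 hx
      have hn : ContinuousAt (fun x : E3 => ‖x‖) x := continuous_norm.continuousAt
      have hψx : ContinuousAt (fun x : E3 => ψ ‖x‖) x :=
        ContinuousAt.comp (g := ψ) (h2 _ hx').continuousAt hn
      have hcx : ContinuousAt (fun x : E3 => c ‖x‖) x :=
        ContinuousAt.comp (g := c) (hc.continuousAt (Ioi_mem_nhds hx')) hn
      have hi : Continuous fun x : E3 => inner ℝ x y * inner ℝ x z := by fun_prop
      exact (hψx.mul continuousAt_const).add (hcx.mul hi.continuousAt)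
  · rw [lap_eq_sum_fderiv, hf1, hf2, sum_hessian_radial]

theorem lap_comp_smul {f : E3 → ℝ} (hf : ContDiff ℝ 2 f) (a : ℝ) (x : E3) :
    lap (fun y => f (a • y)) x = a ^ 2 * lap f (a • x) := by
  have h := iteratedFDeriv_comp_const_smul (i := 2) a hf
  simp only [lap, h, Finset.mul_sum]
  rfl

namespace IsProfile

variable {p : ℝ} {G H : ℝ → ℝ}

/-- The radial function `G / t`, extended by its limit at the origin. -/
noncomputable def profile (G : ℝ → ℝ) : ℝ → ℝ := Function.update (fun t => G t / t) 0 1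

theorem profile_zero (G : ℝ → ℝ) : profile G 0 = 1 := Function.update_self _ _ _

theorem profile_of_ne {t : ℝ} (ht : t ≠ 0) : profile G t = G t / t :=
  Function.update_of_ne ht _ _

theorem profile_le_one (h : IsProfile p G H) {t : ℝ} (ht : 0 ≤ t) : profile G t ≤ 1 := by
  rcases ht.eq_or_lt with rfl | ht
  · rw [profile_zero]
  · rw [profile_of_ne ht.ne']
    exact h.div_le_one ht

theorem neg_le_mul_sub (h : IsProfile p G H) (hp : 1 ≤ p) {t : ℝ} (ht : 0 ≤ t) :
    -(t ^ 3 / 3) ≤ t * H t - G t := by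
  have hd : ∀ t, HasDerivAt (fun t => t * H t - G t + t ^ 3 / 3)
      (-(t ^ 2 * truncPow p (G t / t)) + t ^ 2) t := fun t =>
    ((h.hasDerivAt_mul_sub t).add ((hasDerivAt_pow 3 t).div_const 3)).congr_deriv
      (by push_cast; ring)
  have hmono : Monotone fun t => t * H t - G t + t ^ 3 / 3 :=
    monotone_of_deriv_nonneg (fun t => (hd t).differentiableAt) fun t => by
      rw [(hd t).deriv]
      have h1 := truncPow_le_one hp (G t / t)
      nlinarith [sq_nonneg t]
  have := hmono ht
  simp only [h.fst_zero] at this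
  norm_num at this
  linarith

theorem one_sub_le_div (h : IsProfile p G H) (hp : 1 ≤ p) {t : ℝ} (ht : 0 < t) :
    1 - t ^ 2 / 6 ≤ G t / t := by
  have hd : ∀ t, 0 < t → HasDerivAt (fun t => G t / t + t ^ 2 / 6)
      ((t * H t - G t) / t ^ 2 + t / 3) t := fun t ht =>
    ((h.hasDerivAt_div ht.ne').add ((hasDerivAt_pow 2 t).div_const 6)).congr_deriv
      (by push_cast; ring)
  have hmono : MonotoneOn (fun t => G t / t + t ^ 2 / 6) (Ioi 0) := by
    refine monotoneOn_of_deriv_nonneg (convex_Ioi 0)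
      (fun t ht => (hd t ht).continuousAt.continuousWithinAt)
      (fun t ht => (hd t (interior_subset ht)).differentiableAt.differentiableWithinAt)
      fun t ht => ?_
    rw [interior_Ioi] at ht
    replace ht : 0 < t := ht
    rw [(hd t ht).deriv]
    have h1 := h.neg_le_mul_sub hp ht.le
    have h2 : -(t ^ 3 / 3) / t ^ 2 ≤ (t * H t - G t) / t ^ 2 := by gcongr
    have h3 : -(t ^ 3 / 3) / t ^ 2 = -(t / 3) := by field_simp
    linarith
  have hlim : Tendsto (fun t => G t / t + t ^ 2 / 6) (𝓝[>] 0) (𝓝 1) := by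
    have h1 : Tendsto (fun t : ℝ => t ^ 2 / 6) (𝓝[>] 0) (𝓝 0) := by
      have : Continuous fun t : ℝ => t ^ 2 / 6 := by fun_prop
      simpa using (this.tendsto 0).mono_left (nhdsWithin_le_nhds (s := Ioi 0))
    simpa using h.tendsto_div_zero.add h1
  have : 1 ≤ G t / t + t ^ 2 / 6 := by
    refine le_of_tendsto hlim ?_
    filter_upwards [Ioo_mem_nhdsGT ht] with s hs
    exact hmono hs.1 ht hs.2.le
  linarith

theorem tendsto_mul_sub_div (h : IsProfile p G H) (hp : 1 ≤ p) :
    Tendsto (fun t => (t * H t - G t) / t ^ 3) (𝓝[>] 0) (𝓝 (-(1 / 3))) := by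
  have hF : Tendsto (fun t => -(truncPow p (G t / t) / 3)) (𝓝[>] 0) (𝓝 (-(1 / 3))) := by
    have := ((continuous_truncPow hp).tendsto 1).comp h.tendsto_div_zero
    rw [truncPow_of_mem p zero_le_one le_rfl, Real.one_rpow] at this
    exact (this.div_const 3).neg
  refine tendsto_of_tendsto_of_tendsto_of_le_of_le' tendsto_const_nhds hF ?_ ?_
  · filter_upwards [self_mem_nhdsWithin] with t ht
    replace ht : 0 < t := ht
    rw [le_div_iff₀ (by positivity)]
    linarith [h.neg_le_mul_sub hp ht.le]
  · filter_upwards [self_mem_nhdsWithin] with t ht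
    replace ht : 0 < t := ht
    rw [div_le_iff₀ (by positivity)]
    linarith [h.mul_sub_le (by linarith) ht]

theorem contDiff_profile_norm (h : IsProfile p G H) (hp : 1 ≤ p) :
    ContDiff ℝ 2 (fun x : E3 => profile G ‖x‖) ∧
      ∀ x : E3, lap (fun x : E3 => profile G ‖x‖) x = -truncPow p (profile G ‖x‖) := by
  set ψ : ℝ → ℝ := Function.update (fun t => (t * H t - G t) / t ^ 3) 0 (-(1 / 3)) with hψ
  set c : ℝ → ℝ := fun t => -(truncPow p (G t / t) / t ^ 2) - 3 * (t * H t - G t) / t ^ 5 with hc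
  have hev : ∀ t : ℝ, 0 < t → ∀ᶠ s in 𝓝 t, s ≠ 0 := fun t ht => isOpen_ne.mem_nhds ht.ne'
  have hψ0 : ψ 0 = -(1 / 3) := Function.update_self _ _ _
  have hψt : ∀ t, t ≠ 0 → ψ t = (t * H t - G t) / t ^ 3 := fun t ht => Function.update_of_ne ht _ _
  have h1 : ∀ t, 0 < t → HasDerivAt (profile G) (t * ψ t) t := fun t ht => by
    refine ((h.hasDerivAt_div ht.ne').congr_of_eventuallyEq ?_).congr_deriv ?_
    · filter_upwards [hev t ht] with s hs using profile_of_ne hs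
    · rw [hψt t ht.ne']; field_simp
  have h2 : ∀ t, 0 < t → HasDerivAt ψ (t * c t) t := fun t ht => by
    refine (((h.hasDerivAt_mul_sub t).div (hasDerivAt_pow 3 t)
      (pow_ne_zero 3 ht.ne')).congr_of_eventuallyEq ?_).congr_deriv ?_
    · filter_upwards [hev t ht] with s hs using hψt s hs
    · simp only [hc]
      field_simp
      push_cast
      ring
  have hO : (fun x : E3 => profile G ‖x‖ - profile G 0) =O[𝓝 0] fun x => ‖x - 0‖ ^ 2 := by
    refine Asymptotics.IsBigO.of_bound 1 (Eventually.of_forall fun x => ?_)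
    rw [profile_zero, sub_zero, one_mul, norm_pow, norm_norm, Real.norm_eq_abs]
    rcases eq_or_ne x 0 with rfl | hx
    · simp [profile_zero]
    · have hx' : 0 < ‖x‖ := norm_pos_iff.2 hx
      rw [profile_of_ne hx'.ne', abs_le]
      have h3 := h.one_sub_le_div hp hx'
      have h4 := h.div_le_one hx'
      constructor <;> nlinarith [sq_nonneg ‖x‖]
  have hψc : ContinuousWithinAt ψ (Ici 0) 0 := by
    rw [← continuousWithinAt_Ioi_iff_Ici, ContinuousWithinAt, hψ0]
    refine (h.tendsto_mul_sub_div hp).congr' ?_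
    filter_upwards [self_mem_nhdsWithin] with t ht using (hψt t (ne_of_gt ht)).symm
  have hcc : ContinuousOn c (Ioi 0) := fun t ht => by
    have ht0 : t ≠ 0 := ne_of_gt ht
    refine ContinuousAt.continuousWithinAt ?_
    exact ((((continuous_truncPow hp).continuousAt.comp (h.hasDerivAt_div ht0).continuousAt).div
      (continuousAt_id.pow 2) (pow_ne_zero 2 ht0)).neg).sub
      ((continuousAt_const.mul (h.hasDerivAt_mul_sub t).continuousAt).div
        (continuousAt_id.pow 5) (pow_ne_zero 5 ht0))
  have hc2 : ∀ t, 0 < t → t ^ 2 * c t = -truncPow p (G t / t) - 3 * ((t * H t - G t) / t ^ 3) :=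
    fun t ht => by simp only [hc]; field_simp
  have hc0 : Tendsto (fun t => t ^ 2 * c t) (𝓝[≥] 0) (𝓝 0) := by
    have h3 : ContinuousWithinAt (fun t => t ^ 2 * c t) (Ioi 0) 0 := by
      have h4 := ((continuous_truncPow hp).tendsto 1).comp h.tendsto_div_zero
      rw [truncPow_of_mem p zero_le_one le_rfl, Real.one_rpow] at h4
      have h5 := h4.neg.sub ((h.tendsto_mul_sub_div hp).const_mul 3)
      norm_num at h5
      rw [ContinuousWithinAt, zero_pow two_ne_zero, zero_mul]
      refine h5.congr' ?_
      filter_upwards [self_mem_nhdsWithin] with t ht using (hc2 t ht).symm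
    have := (continuousWithinAt_Ioi_iff_Ici.1 h3).tendsto
    simpa using this
  obtain ⟨hcd, hlap⟩ := contDiff_radial h1 h2 hO hψc hcc hc0
  refine ⟨hcd, fun x => ?_⟩
  rw [hlap]
  rcases eq_or_ne x 0 with rfl | hx
  · rw [norm_zero, hψ0, profile_zero, truncPow_of_mem p zero_le_one le_rfl, Real.one_rpow]
    norm_num
  · have hx' : 0 < ‖x‖ := norm_pos_iff.2 hx
    rw [hc2 _ hx', hψt _ hx'.ne', profile_of_ne hx'.ne']
    ring

/-- The positive solution obtained from the profile by scaling, `L` being the limit of the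
profile at infinity. -/
theorem isCellSolution (h : IsProfile p G H) (hp : 1 < p) {L : ℝ} (hL : L < 0)
    (hlim : Tendsto (fun t => G t / t) atTop (𝓝 L)) (hgt : ∀ t, 0 < t → L < G t / t) :
    IsCellSolution p (fun x => 1 + (-L)⁻¹ * profile G ‖((-L)⁻¹ ^ ((p - 1) / 2)) • x‖) ∧
      ∀ x : E3, 0 < 1 + (-L)⁻¹ * profile G ‖((-L)⁻¹ ^ ((p - 1) / 2)) • x‖ := by
  obtain ⟨hcd, hlap⟩ := h.contDiff_profile_norm hp.le
  have hκ : 0 < (-L)⁻¹ := inv_pos.2 (by linarith)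
  have hκL : (-L)⁻¹ * L = -1 := by rw [inv_neg, neg_mul, inv_mul_cancel₀ hL.ne]
  set κ := (-L)⁻¹
  have hlam : 0 < κ ^ ((p - 1) / 2) := Real.rpow_pos_of_pos hκ _
  have hscale : κ * (κ ^ ((p - 1) / 2)) ^ 2 = κ ^ p := by
    rw [← Real.rpow_natCast, ← Real.rpow_mul hκ.le]
    nth_rewrite 1 [← Real.rpow_one κ]
    rw [← Real.rpow_add hκ]
    congr 1
    push_cast
    ring
  set lam := κ ^ ((p - 1) / 2)
  have hcd' : ContDiff ℝ 2 fun x : E3 => profile G ‖lam • x‖ :=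
    hcd.comp (contDiff_id.const_smul lam)
  refine ⟨⟨contDiff_const.add (contDiff_const.mul hcd'), fun x => ?_, ?_⟩, fun x => ?_⟩
  · have h1 : lap (fun x : E3 => 1 + κ * profile G ‖lam • x‖) x =
        κ * (lam ^ 2 * -truncPow p (profile G ‖lam • x‖)) := by
      rw [← hlap, ← lap_comp_smul hcd, ← lap_const_mul κ hcd'.contDiffAt]
      simp only [lap_eq_laplacian]
      have h3 := lap_sub (f := fun x : E3 => κ * profile G ‖lam • x‖) (g := fun _ => -1) (x := x)
        (contDiff_const.mul hcd').contDiffAt contDiffAt_const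
      simp only [lap_eq_laplacian, sub_neg_eq_add] at h3
      simp only [add_comm (1 : ℝ)]
      rw [h3]
      simp
    rw [h1, truncPow_of_le_one p (h.profile_le_one (norm_nonneg _)), add_sub_cancel_left]
    generalize profile G ‖lam • x‖ = v
    have h4 : max (κ * v) 0 = κ * max v 0 := by
      rw [mul_max_of_nonneg _ _ hκ.le, mul_zero]
    rw [h4, Real.mul_rpow hκ.le (le_max_right _ _), ← hscale]
    ring
  · have h1 : Tendsto (fun t : ℝ => 1 + κ * profile G t) atTop (𝓝 0) := by
      have := (hlim.const_mul κ).const_add 1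
      rw [hκL, add_neg_cancel] at this
      refine this.congr' ?_
      filter_upwards [eventually_gt_atTop 0] with t ht
      rw [profile_of_ne ht.ne']
    have h2 : Tendsto (fun x : E3 => ‖lam • x‖) (cocompact E3) atTop := by
      simp only [norm_smul, Real.norm_eq_abs, abs_of_pos hlam]
      exact tendsto_norm_cocompact_atTop.const_mul_atTop hlam
    exact h1.comp h2
  · rcases (norm_nonneg (lam • x)).eq_or_lt with h1 | h1
    · rw [← h1, profile_zero]
      linarith
    · rw [profile_of_ne h1.ne']
      have := mul_lt_mul_of_pos_left (hgt _ h1) hκ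
      linarith

end IsProfile

theorem IsProfile.unique {p : ℝ} (hp : 1 ≤ p) {G₁ H₁ G₂ H₂ : ℝ → ℝ} (h₁ : IsProfile p G₁ H₁)
    (h₂ : IsProfile p G₂ H₂) : G₁ = G₂ := by
  have h : (fun t => (G₁ t, H₁ t)) = fun t => (G₂ t, H₂ t) :=
    ODE_solution_unique_univ (v := radialField p) (s := fun _ => univ) (t₀ := 0)
      (fun t => (lipschitzWith_radialField hp t).lipschitzOnWith)
      (fun t => ⟨(h₁.hasDerivAt_fst t).prodMk (h₁.hasDerivAt_snd t), mem_univ _⟩)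
      (fun t => ⟨(h₂.hasDerivAt_fst t).prodMk (h₂.hasDerivAt_snd t), mem_univ _⟩)
      (by rw [h₁.fst_zero, h₁.snd_zero, h₂.fst_zero, h₂.snd_zero])
  exact funext fun t => congrArg Prod.fst (congrFun h t)

theorem IsCellSolution.comp_add_right {p : ℝ} {u : E3 → ℝ} (hu : IsCellSolution p u) (a : E3) :
    IsCellSolution p fun x => u (x + a) :=
  ⟨hu.1.comp (contDiff_id.add contDiff_const),
    fun x => by rw [lap_comp_add_right]; exact hu.2.1 (x + a),
    hu.2.2.comp (Homeomorph.addRight a).isClosedEmbedding.tendsto_cocompact⟩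

/-- A positive solution exceeds the threshold `1` at some point. -/
theorem IsCellSolution.exists_one_lt {p : ℝ} (hp : 0 < p) {u : E3 → ℝ} (hu : IsCellSolution p u)
    (hpos : ∀ x, 0 < u x) : ∃ x, 1 < u x := by
  by_contra! hle
  have hlap : ∀ x, lap (fun y => - u y) x = 0 := fun x => by
    rw [lap_neg, hu.lap_eq, max_eq_right (sub_nonpos.2 (hle x)), Real.zero_rpow hp.ne', neg_zero,
      neg_zero]
  have := le_of_lap_nonpos_of_tendsto (v := fun y => -u y) isClosed_univ
    hu.1.continuous.fun_neg.continuousOn (by simpa using hu.2.2.neg) le_rfl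
    (fun x _ => Or.inr ⟨univ_mem, hu.1.contDiffAt.neg, (hlap x).le⟩) (0 : E3) (mem_univ _)
  have h0 := hpos 0
  linarith

/-- The radial restriction `φ` of a radial solution solves `t φ'' + 2 φ' = - t (φ - 1)₊ ^ p`. -/
theorem IsCellSolution.exists_radial_ode {p : ℝ} {w : E3 → ℝ} (hw : IsCellSolution p w)
    (hr : ∀ x y, ‖x‖ = ‖y‖ → w x = w y) :
    ∃ φ φ' φ'' : ℝ → ℝ, (∀ x, w x = φ ‖x‖) ∧ (∀ t, φ (-t) = φ t) ∧
      (∀ t, HasDerivAt φ (φ' t) t) ∧ (∀ t, HasDerivAt φ' (φ'' t) t) ∧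
      ∀ t, 2 * φ' t + t * φ'' t = -(t * (max (φ t - 1) 0) ^ p) := by
  obtain ⟨e, he⟩ : ∃ e : E3, ‖e‖ = 1 := ⟨EuclideanSpace.single 0 1, by simp⟩
  set φ : ℝ → ℝ := fun t => w (t • e) with hφ
  have hcd : ContDiff ℝ 2 φ := hw.1.comp (contDiff_id.smul contDiff_const)
  have hwφ : ∀ x, w x = φ ‖x‖ := fun x => hr _ _ (by rw [norm_smul, he, norm_norm, mul_one])
  have heven : ∀ t, φ (-t) = φ t := fun t => hr _ _ (by rw [neg_smul, norm_neg])
  have hd1 : ∀ t, HasDerivAt φ (deriv φ t) t := fun t =>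
    ((hcd.differentiable two_ne_zero) t).hasDerivAt
  have hcd1 : ContDiff ℝ 1 (deriv φ) :=
    (contDiff_succ_iff_deriv.1 (show ContDiff ℝ (1 + 1) φ by norm_num; exact hcd)).2.2
  have hd2 : ∀ t, HasDerivAt (deriv φ) (deriv (deriv φ) t) t := fun t =>
    ((hcd1.differentiable one_ne_zero) t).hasDerivAt
  have hodd : ∀ t, deriv φ (-t) = -deriv φ t := fun t => by
    have h := deriv_comp_neg (f := φ) t
    rw [funext heven] at h
    linarith
  have heven2 : ∀ t, deriv (deriv φ) (-t) = deriv (deriv φ) t := fun t => by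
    have h := deriv_comp_neg (f := deriv φ) t
    rw [funext hodd, deriv.fun_neg] at h
    linarith
  have hode : ∀ t, 0 < t →
      2 * deriv φ t + t * deriv (deriv φ) t = -(t * (max (φ t - 1) 0) ^ p) := fun t ht => by
    have hn : ‖t • e‖ = t := by rw [norm_smul, he, mul_one, Real.norm_eq_abs, abs_of_pos ht]
    have hx : t • e ≠ 0 := norm_ne_zero_iff.1 (by rw [hn]; exact ht.ne')
    have h := lap_radial (φ := φ) (ψ := fun t => deriv φ t / t)
      (c := (deriv (deriv φ) t * t - deriv φ t) / t ^ 3) hx ?_ ?_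
    · rw [← funext hwφ, hw.lap_eq, hn] at h
      change -(max (φ t - 1) 0) ^ p = _ at h
      have h' : 3 * (deriv φ t / t) + t ^ 2 * ((deriv (deriv φ) t * t - deriv φ t) / t ^ 3) =
          (2 * deriv φ t + t * deriv (deriv φ) t) / t := by
        field_simp
        ring
      rw [h', eq_div_iff ht.ne'] at h
      linarith
    · rw [hn]
      filter_upwards [eventually_gt_nhds ht] with s hs
      exact (hd1 s).congr_deriv (by field_simp)
    · rw [hn]
      refine ((hd2 t).div (hasDerivAt_id t) ht.ne').congr_deriv ?_
      simp only [id]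
      field_simp
  refine ⟨φ, deriv φ, deriv (deriv φ), hwφ, heven, hd1, hd2, fun t => ?_⟩
  rcases lt_trichotomy t 0 with ht | rfl | ht
  · have h := hode (-t) (neg_pos.2 ht)
    rw [hodd, heven2, heven] at h
    linarith
  · have h := hodd 0
    rw [neg_zero] at h
    linarith
  · exact hode t ht

/-- A positive solution which is radial about the origin is a rescaled profile. -/
theorem IsCellSolution.eq_of_radial {p : ℝ} (hp : 1 < p) {w : E3 → ℝ} (hw : IsCellSolution p w)
    (hpos : ∀ x, 0 < w x) (hr : ∀ x y, ‖x‖ = ‖y‖ → w x = w y) {G H : ℝ → ℝ}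
    (hG : IsProfile p G H) {L : ℝ}
    (hlim : Tendsto (fun t => G t / t) atTop (𝓝 L)) (x : E3) :
    w x = 1 + (-L)⁻¹ * IsProfile.profile G ‖((-L)⁻¹ ^ ((p - 1) / 2)) • x‖ := by
  obtain ⟨φ, φ', φ'', hwφ, heven, hd1, hd2, hode⟩ := hw.exists_radial_ode hr
  have hsq : ∀ t, 0 ≤ t → t ^ 2 * φ' t ≤ 0 := fun t ht => by
    have hd : ∀ t, HasDerivAt (fun t => t ^ 2 * φ' t) (-(t ^ 2 * (max (φ t - 1) 0) ^ p)) t :=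
      fun t => ((hasDerivAt_pow 2 t).mul (hd2 t)).congr_deriv (by
        push_cast
        linear_combination t * hode t)
    have hanti : Antitone fun t => t ^ 2 * φ' t :=
      antitone_of_deriv_nonpos (fun t => (hd t).differentiableAt) fun t => by
        rw [(hd t).deriv]
        have := Real.rpow_nonneg (le_max_right (φ t - 1) 0) p
        nlinarith [sq_nonneg t]
    simpa using hanti ht
  have hmax : ∀ t, φ t ≤ φ 0 := by
    have hanti : AntitoneOn φ (Ici 0) :=
      antitoneOn_of_deriv_nonpos (convex_Ici 0)
        (fun t _ => (hd1 t).continuousAt.continuousWithinAt)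
        (fun t _ => (hd1 t).differentiableAt.differentiableWithinAt) fun t ht => by
          rw [interior_Ici] at ht
          rw [(hd1 t).deriv]
          exact nonpos_of_mul_nonpos_right (hsq t (le_of_lt ht)) (pow_pos ht 2)
    intro t
    rcases le_total 0 t with ht | ht
    · exact hanti self_mem_Ici ht ht
    · rw [← heven]
      exact hanti self_mem_Ici (neg_nonneg.2 ht) (neg_nonneg.2 ht)
  have ha : 0 < φ 0 - 1 := by
    obtain ⟨y, hy⟩ := hw.exists_one_lt (by linarith) hpos
    rw [hwφ] at hy
    linarith [hmax ‖y‖]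
  set a := φ 0 - 1 with hadef
  set lam := a ^ ((p - 1) / 2) with hlamdef
  have hlam : 0 < lam := Real.rpow_pos_of_pos ha _
  have hscale : a * lam ^ 2 = a ^ p := by
    rw [hlamdef, ← Real.rpow_natCast, ← Real.rpow_mul ha.le]
    nth_rewrite 1 [← Real.rpow_one a]
    rw [← Real.rpow_add ha]
    congr 1
    push_cast
    ring
  have hprof : IsProfile p (fun t => a⁻¹ * (t * (φ (t / lam) - 1)))
      (fun t => a⁻¹ * (φ (t / lam) - 1 + t * (φ' (t / lam) / lam))) := by
    have hs : ∀ t : ℝ, HasDerivAt (fun t => t / lam) (1 / lam) t := fun t =>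
      (hasDerivAt_id t).div_const lam
    have e1 : ∀ t, HasDerivAt (fun t => φ (t / lam) - 1) (φ' (t / lam) / lam) t := fun t =>
      (((hd1 _).comp t (hs t)).sub_const 1).congr_deriv (by ring)
    have e2 : ∀ t, HasDerivAt (fun t => φ' (t / lam) / lam) (φ'' (t / lam) / lam ^ 2) t := fun t =>
      (((hd2 _).comp t (hs t)).div_const lam).congr_deriv (by field_simp)
    refine ⟨fun t => ?_, fun t => ?_, by simp, ?_⟩
    · exact (((hasDerivAt_id t).mul (e1 t)).const_mul a⁻¹).congr_deriv (by simp)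
    · refine (((e1 t).add ((hasDerivAt_id t).mul (e2 t))).const_mul a⁻¹).congr_deriv ?_
      rcases eq_or_ne t 0 with rfl | ht
      · have h0 := hode 0
        simp only [zero_mul, add_zero, neg_zero] at h0
        have h0' : φ' 0 = 0 := by linarith
        simp [h0']
      · have h1 : a⁻¹ * (t * (φ (t / lam) - 1)) / t = (φ (t / lam) - 1) / a := by
          field_simp
        have h2 : (φ (t / lam) - 1) / a ≤ 1 := by
          rw [div_le_one ha]
          linarith [hmax (t / lam)]
        have h3 : (max ((φ (t / lam) - 1) / a) 0) ^ p = (max (φ (t / lam) - 1) 0) ^ p / a ^ p := by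
          rw [← Real.div_rpow (le_max_right _ _) ha.le, ← max_div_div_right ha.le, zero_div]
        rw [h1, truncPow_of_le_one p h2, h3, ← hscale]
        have h4 := hode (t / lam)
        have h5 : t * (max (φ (t / lam) - 1) 0) ^ p =
            -(lam * (2 * φ' (t / lam) + t / lam * φ'' (t / lam))) := by
          rw [h4]
          field_simp
        rw [← mul_div_assoc t, h5]
        simp only [id]
        field_simp
        ring
    · simp only [zero_div, zero_mul, add_zero]
      exact inv_mul_cancel₀ ha.ne'
  have hGeq : ∀ t, G t = a⁻¹ * (t * (φ (t / lam) - 1)) := fun t =>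
    congrFun (hG.unique hp.le hprof) t
  have hφG : ∀ t, 0 < t → φ t = 1 + a * (G (lam * t) / (lam * t)) := fun t ht => by
    rw [hGeq, mul_div_cancel_left₀ _ hlam.ne']
    field_simp
    ring
  have haL : a * L = -1 := by
    have h1 : Tendsto (fun t => 1 + a * (G (lam * t) / (lam * t))) atTop (𝓝 (1 + a * L)) :=
      ((hlim.comp (tendsto_id.const_mul_atTop hlam)).const_mul a).const_add 1
    have h2 : Tendsto (fun n : ℕ => φ n) atTop (𝓝 0) := by
      have he : ‖(EuclideanSpace.single 0 1 : E3)‖ = 1 := by simp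
      refine (hw.2.2.comp (tendsto_smul_cocompact he one_ne_zero)).congr fun n => ?_
      rw [Function.comp_apply, hwφ, norm_smul, he, mul_one, mul_one, Real.norm_natCast]
    have h3 : Tendsto (fun n : ℕ => φ n) atTop (𝓝 (1 + a * L)) := by
      refine (h1.comp tendsto_natCast_atTop_atTop).congr' ?_
      filter_upwards [eventually_gt_atTop 0] with n hn
      exact (hφG n (by exact_mod_cast hn)).symm
    linarith [tendsto_nhds_unique h2 h3]
  have hκ : (-L)⁻¹ = a := inv_eq_of_mul_eq_one_left (by linarith)
  rw [hκ, hwφ, norm_smul, Real.norm_eq_abs, abs_of_pos hlam]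
  rcases eq_or_ne x 0 with rfl | hx
  · rw [norm_zero, mul_zero, IsProfile.profile_zero]
    linarith
  · have hx' : 0 < ‖x‖ := norm_pos_iff.2 hx
    rw [IsProfile.profile_of_ne (mul_pos hlam hx').ne', hφG _ hx']

end CellProblem

/-- for `3/2 < p < 5`, the basic cell problem has a positive solution which
is radially symmetric about some point, and positive solutions are unique up to
translations. -/
theorem stmt9 (p : ℝ) (hp1 : 3 / 2 < p) (hp2 : p < 5) :
    (∃ (w : EuclideanSpace ℝ (Fin 3) → ℝ) (x₀ : EuclideanSpace ℝ (Fin 3)),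
      IsCellSolution p w ∧ (∀ x, 0 < w x) ∧
      ∀ x y, ‖x - x₀‖ = ‖y - x₀‖ → w x = w y) ∧
    (∀ w₁ w₂ : EuclideanSpace ℝ (Fin 3) → ℝ,
      IsCellSolution p w₁ → (∀ x, 0 < w₁ x) →
      IsCellSolution p w₂ → (∀ x, 0 < w₂ x) →
      ∃ c : EuclideanSpace ℝ (Fin 3), ∀ x, w₂ x = w₁ (x + c)) := by
  have hp : 1 < p := by linarith
  obtain ⟨G, H, h⟩ := exists_isProfile hp.le
  obtain ⟨L, hL, hlim, hgt⟩ := h.exists_limit hp hp2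
  obtain ⟨hsol, hpos⟩ := h.isCellSolution hp hL hlim hgt
  refine ⟨⟨_, 0, hsol, hpos, fun x y hxy => ?_⟩, fun w₁ w₂ h₁ hpos₁ h₂ hpos₂ => ?_⟩
  · rw [sub_zero, sub_zero] at hxy
    simp only [norm_smul, hxy]
  · obtain ⟨x₁, hx₁⟩ := exists_radial_center (by linarith) h₁ hpos₁
    obtain ⟨x₂, hx₂⟩ := exists_radial_center (by linarith) h₂ hpos₂
    refine ⟨x₁ - x₂, fun x => ?_⟩
    have e₁ := (h₁.comp_add_right x₁).eq_of_radial hp (fun x => hpos₁ _) hx₁ h hlim (x - x₂)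
    have e₂ := (h₂.comp_add_right x₂).eq_of_radial hp (fun x => hpos₂ _) hx₂ h hlim (x - x₂)
    rw [sub_add_cancel] at e₂
    rw [e₂, ← e₁]
    congr 1
    abel
end
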